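/- arXiv:1903.00208 — 6 statements merged into one kernel-verified Lean document; each statement's English description precedes it below -/
import Mathlib

section
/- Let G be a graph containing no jewel or pyramid, and let C be a clean shortest odd hole in G. Let u, v ∈ V(C) be distinct and nonadjacent, and let L1, L2 be the two subpaths of C joining u and v, where |E(L1)| < |E(L2)|. Then for every shortest path P in G between u and v, the subgraph P ∪ L2 is a shortest odd hole in G. -/
/-!
Common definitions: holes, odd holes, C-major vertices, induced paths,
pyramids, jewels, candidates, x-gaps, gaps and normal sets.
A hole of length `n` is encoded as an injective map `f : ZMod n → V`
such that adjacency in `G` between vertices of the hole holds exactly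
for consecutive indices (i.e. the hole is an induced cycle).
-/

variable {V : Type*}

/-- A hole: an induced cycle of length `n ≥ 4`. -/
def IsHole (G : SimpleGraph V) (n : ℕ) (f : ZMod n → V) : Prop :=
  4 ≤ n ∧ Function.Injective f ∧
    ∀ i j : ZMod n, G.Adj (f i) (f j) ↔ (j = i + 1 ∨ i = j + 1)

/-- An odd hole. -/
def IsOddHole (G : SimpleGraph V) (n : ℕ) (f : ZMod n → V) : Prop :=
  IsHole G n f ∧ Odd n

/-- A shortest odd hole: an odd hole of minimum length among all odd holes. -/
def IsShortestOddHole (G : SimpleGraph V) (n : ℕ) (f : ZMod n → V) : Prop :=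
  IsOddHole G n f ∧ ∀ (m : ℕ) (g : ZMod m → V), IsOddHole G m g → n ≤ m

/-- `G` has an odd hole. -/
def HasOddHole (G : SimpleGraph V) : Prop :=
  ∃ (n : ℕ) (f : ZMod n → V), IsOddHole G n f

/-- A vertex `v` is `C`-major (for the hole given by `f`): `v` is not on the hole and
no three consecutive vertices of the hole contain all neighbours of `v` on the hole. -/
def IsCMajor (G : SimpleGraph V) {n : ℕ} (f : ZMod n → V) (v : V) : Prop :=
  v ∉ Set.range f ∧
    ∀ i : ZMod n, ∃ j : ZMod n, G.Adj v (f j) ∧ j ≠ i - 1 ∧ j ≠ i ∧ j ≠ i + 1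

/-- An induced path of length `k`, encoded by its sequence of vertices:
adjacency holds exactly between consecutive vertices. -/
def IsInducedPathMap (G : SimpleGraph V) (k : ℕ) (p : Fin (k + 1) → V) : Prop :=
  Function.Injective p ∧
    ∀ i j : Fin (k + 1), G.Adj (p i) (p j) ↔ (i.val + 1 = j.val ∨ j.val + 1 = i.val)

/-- A (not necessarily induced) path of length `k`, encoded by its sequence of vertices. -/
def IsPathMap (G : SimpleGraph V) (k : ℕ) (p : Fin (k + 1) → V) : Prop :=
  Function.Injective p ∧ ∀ i : Fin k, G.Adj (p i.castSucc) (p i.succ)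

/-- A pyramid with apex `v0`, base `{v1, v2, v3}`, and paths `p1, p2, p3`
(of lengths `k1, k2, k3`) from `v0` to `v1, v2, v3` respectively. -/
def IsPyramid (G : SimpleGraph V) (v0 v1 v2 v3 : V) (k1 k2 k3 : ℕ)
    (p1 : Fin (k1 + 1) → V) (p2 : Fin (k2 + 1) → V) (p3 : Fin (k3 + 1) → V) : Prop :=
  IsInducedPathMap G k1 p1 ∧ IsInducedPathMap G k2 p2 ∧ IsInducedPathMap G k3 p3 ∧
  p1 0 = v0 ∧ p2 0 = v0 ∧ p3 0 = v0 ∧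
  p1 (Fin.last k1) = v1 ∧ p2 (Fin.last k2) = v2 ∧ p3 (Fin.last k3) = v3 ∧
  v1 ≠ v0 ∧ v2 ≠ v0 ∧ v3 ≠ v0 ∧
  G.Adj v1 v2 ∧ G.Adj v1 v3 ∧ G.Adj v2 v3 ∧
  ((2 ≤ k1 ∧ 2 ≤ k2) ∨ (2 ≤ k1 ∧ 2 ≤ k3) ∨ (2 ≤ k2 ∧ 2 ≤ k3)) ∧
  (Set.range p1 ∩ Set.range p2 ⊆ {v0}) ∧
  (Set.range p1 ∩ Set.range p3 ⊆ {v0}) ∧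
  (Set.range p2 ∩ Set.range p3 ⊆ {v0}) ∧
  (∀ u w : V, u ∈ Set.range p1 → w ∈ Set.range p2 → u ≠ v0 → w ≠ v0 →
    G.Adj u w → u = v1 ∧ w = v2) ∧
  (∀ u w : V, u ∈ Set.range p1 → w ∈ Set.range p3 → u ≠ v0 → w ≠ v0 →
    G.Adj u w → u = v1 ∧ w = v3) ∧
  (∀ u w : V, u ∈ Set.range p2 → w ∈ Set.range p3 → u ≠ v0 → w ≠ v0 →
    G.Adj u w → u = v2 ∧ w = v3)

/-- `G` contains a pyramid. -/
def ContainsPyramid (G : SimpleGraph V) : Prop :=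
  ∃ (v0 v1 v2 v3 : V) (k1 k2 k3 : ℕ) (p1 : Fin (k1 + 1) → V)
    (p2 : Fin (k2 + 1) → V) (p3 : Fin (k3 + 1) → V),
    IsPyramid G v0 v1 v2 v3 k1 k2 k3 p1 p2 p3

/-- A jewel on vertices `v1, …, v5` together with the path `p` (of length `k`)
from `v1` to `v4`. -/
def IsJewel (G : SimpleGraph V) (v1 v2 v3 v4 v5 : V) (k : ℕ)
    (p : Fin (k + 1) → V) : Prop :=
  List.Pairwise Ne [v1, v2, v3, v4, v5] ∧
  G.Adj v1 v2 ∧ G.Adj v2 v3 ∧ G.Adj v3 v4 ∧ G.Adj v4 v5 ∧ G.Adj v5 v1 ∧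
  ¬ G.Adj v1 v3 ∧ ¬ G.Adj v2 v4 ∧ ¬ G.Adj v1 v4 ∧
  IsInducedPathMap G k p ∧ p 0 = v1 ∧ p (Fin.last k) = v4 ∧
  ∀ i : Fin (k + 1), i ≠ 0 → i ≠ Fin.last k →
    ¬ G.Adj v2 (p i) ∧ ¬ G.Adj v3 (p i) ∧ ¬ G.Adj v5 (p i)

/-- `G` contains a jewel. -/
def ContainsJewel (G : SimpleGraph V) : Prop :=
  ∃ (v1 v2 v3 v4 v5 : V) (k : ℕ) (p : Fin (k + 1) → V),
    IsJewel G v1 v2 v3 v4 v5 k p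

/-- A candidate: a graph with no jewel, no pyramid, and no heavy-cleanable shortest
odd hole (a shortest odd hole is heavy-cleanable if some edge of it has the property
that every major vertex is adjacent to one of its ends). -/
def Candidate (G : SimpleGraph V) : Prop :=
  ¬ ContainsJewel G ∧ ¬ ContainsPyramid G ∧
  ¬ ∃ (n : ℕ) (f : ZMod n → V) (i : ZMod n), IsShortestOddHole G n f ∧
      ∀ v : V, IsCMajor G f v → (G.Adj v (f i) ∨ G.Adj v (f (i + 1)))

/-- An `x`-gap of a hole `f : ZMod n → V`: an induced path of the hole, of length
`ℓ ≥ 2`, starting at index `a` and ending at index `a + ℓ`, whose ends are adjacent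
to `x` and whose internal vertices are nonadjacent to `x`. (The condition `ℓ + 2 ≤ n`
says that the arc is an induced path of the hole.) -/
def IsXGap (G : SimpleGraph V) {n : ℕ} (f : ZMod n → V) (x : V) (a : ZMod n)
    (ℓ : ℕ) : Prop :=
  2 ≤ ℓ ∧ ℓ + 2 ≤ n ∧ G.Adj x (f a) ∧ G.Adj x (f (a + (ℓ : ZMod n))) ∧
    ∀ t : ℕ, 0 < t → t < ℓ → ¬ G.Adj x (f (a + (t : ZMod n)))

/-- `ℓ` is the length of an `A`-gap of the cycle on `ZMod n` (with `A ⊆ ZMod n`):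
either `A = ∅` and the gap is the whole cycle, or the gap runs from some `i ∈ A`
to `i + ℓ ∈ A` with no internal vertex in `A`. -/
def IsGapLength (n : ℕ) (A : Set (ZMod n)) (ℓ : ℕ) : Prop :=
  (A = ∅ ∧ ℓ = n) ∨
  (2 ≤ ℓ ∧ ℓ ≤ n ∧ ∃ i ∈ A, (i + (ℓ : ZMod n)) ∈ A ∧
    ∀ t : ℕ, 0 < t → t < ℓ → (i + (t : ZMod n)) ∉ A)

/-- `A` is normal in the cycle on `ZMod n`: every `A`-gap has even length. -/
def NormalInCycle (n : ℕ) (A : Set (ZMod n)) : Prop :=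
  ∀ ℓ : ℕ, IsGapLength n A ℓ → Even ℓ

/-- An induced cycle of length `n`, listed by an `n`-periodic sequence of vertices. -/
structure CyclicHole (G : SimpleGraph V) (n : ℤ) (c : ℤ → V) : Prop where
  four_le : 4 ≤ n
  periodic : ∀ s t, t = s + n → c t = c s
  ne : ∀ s t, s < t → t < s + n → c s ≠ c t
  adj_iff : ∀ s t, s < t → t < s + n → (G.Adj (c s) (c t) ↔ t = s + 1 ∨ t = s + n - 1)

/-- A periodically listed odd hole of minimum length. -/
structure ShortestOddCyclicHole (G : SimpleGraph V) (n : ℤ) (c : ℤ → V) : Prop where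
  hole : CyclicHole G n c
  odd : Odd n
  le : ∀ (l : ℤ) (g : ℤ → V), CyclicHole G l g → Odd l → n ≤ l

/-- The vertices `p a, …, p b` form an induced path. -/
def InducedOn (G : SimpleGraph V) (p : ℤ → V) (a b : ℤ) : Prop :=
  ∀ s t, a ≤ s → s < t → t ≤ b → p s ≠ p t ∧ (G.Adj (p s) (p t) ↔ t = s + 1)

/-- All neighbours of `w` on the cycle `c` lie among three consecutive vertices. -/
def IsMinor (G : SimpleGraph V) (n : ℤ) (c : ℤ → V) (w : V) : Prop :=
  ∃ z, ∀ t, z ≤ t → t < z + n → G.Adj w (c t) → t ≤ z + 2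

namespace CyclicHole

variable {G : SimpleGraph V} {n : ℤ} {c : ℤ → V}

lemma exists_period (hc : CyclicHole G n c) (a t : ℤ) :
    ∃ e, (∀ s, c (s + e) = c s) ∧ a ≤ t + e ∧ t + e < a + n := by
  have hn := hc.four_le
  have hmul_nat : ∀ (k : ℕ) (s : ℤ), c (s + k * n) = c s := by
    intro k
    induction k with
    | zero => intro s; simp
    | succ k ih =>
      intro s
      rw [← ih s]
      apply hc.periodic
      push_cast
      ring
  have hmul : ∀ (k s : ℤ), c (s + k * n) = c s := by
    intro k s
    rcases Int.le_total 0 k with h | h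
    · obtain ⟨j, rfl⟩ := Int.eq_ofNat_of_zero_le h
      exact hmul_nat j s
    · obtain ⟨j, hj⟩ := Int.eq_ofNat_of_zero_le (show 0 ≤ -k by omega)
      have := hmul_nat j (s + k * n)
      rw [← this, ← hj]
      congr 1
      ring
  have h1 := Int.emod_nonneg (t - a) (show n ≠ 0 by omega)
  have h2 := Int.emod_lt_of_pos (t - a) (show 0 < n by omega)
  have h3 := Int.emod_add_mul_ediv (t - a) n
  refine ⟨-((t - a) / n) * n, hmul _, ?_, ?_⟩ <;> linarith [mul_comm n ((t - a) / n)]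

lemma add_period (hc : CyclicHole G n c) (t : ℤ) : c (t + n) = c t := hc.periodic _ _ rfl

lemma sub_period (hc : CyclicHole G n c) (t : ℤ) : c (t - n) = c t :=
  (hc.periodic _ _ (by omega)).symm

lemma shift (hc : CyclicHole G n c) (a : ℤ) : CyclicHole G n (fun t => c (t + a)) where
  four_le := hc.four_le
  periodic s t h := hc.periodic _ _ (by omega)
  ne s t h h' := hc.ne _ _ (by omega) (by omega)
  adj_iff s t h h' := by
    rw [hc.adj_iff _ _ (by omega) (by omega)]
    omega

lemma reflect (hc : CyclicHole G n c) (a : ℤ) : CyclicHole G n (fun t => c (a - t)) where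
  four_le := hc.four_le
  periodic s t h := (hc.periodic _ _ (by omega)).symm
  ne s t h h' := (hc.ne _ _ (by omega) (by omega)).symm
  adj_iff s t h h' := by
    rw [G.adj_comm, hc.adj_iff _ _ (by omega) (by omega)]
    omega

/-- A list of `l` vertices with the adjacencies of an induced cycle extends periodically. -/
lemma exists_of_window {h : ℤ → V} {x l : ℤ} (hl : 4 ≤ l)
    (hne : ∀ s t, x ≤ s → s < t → t < x + l → h s ≠ h t)
    (hadj : ∀ s t, x ≤ s → s < t → t < x + l →
      (G.Adj (h s) (h t) ↔ t = s + 1 ∨ t = s + l - 1)) :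
    ∃ g, CyclicHole G l g ∧ ∀ t, x ≤ t → t < x + l → g t = h t := by
  have hrem : ∀ s t, s < t → t < s + l →
      (t - x) % l = (s - x) % l + (t - s) ∨ (t - x) % l = (s - x) % l + (t - s) - l := by
    intro s t h1 h2
    have e1 := Int.emod_add_mul_ediv (t - x) l
    have e2 := Int.emod_add_mul_ediv (s - x) l
    have a1 := Int.emod_nonneg (t - x) (show l ≠ 0 by omega)
    have a2 := Int.emod_nonneg (s - x) (show l ≠ 0 by omega)
    have b1 := Int.emod_lt_of_pos (t - x) (show 0 < l by omega)
    have b2 := Int.emod_lt_of_pos (s - x) (show 0 < l by omega)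
    have e3 : l * ((t - x) / l - (s - x) / l) = (t - s) - (t - x) % l + (s - x) % l := by
      rw [mul_sub]
      linarith
    have u1 : (t - x) / l - (s - x) / l < 2 := by nlinarith
    have u2 : -1 < (t - x) / l - (s - x) / l := by nlinarith
    have u3 : (t - x) / l - (s - x) / l = 0 ∨ (t - x) / l - (s - x) / l = 1 := by omega
    rcases u3 with u | u <;> rw [u] at e3
    · left; linarith
    · right; linarith
  have hbd : ∀ t, x ≤ x + (t - x) % l ∧ x + (t - x) % l < x + l := by
    intro t
    have a1 := Int.emod_nonneg (t - x) (show l ≠ 0 by omega)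
    have b1 := Int.emod_lt_of_pos (t - x) (show 0 < l by omega)
    omega
  refine ⟨fun t => h (x + (t - x) % l), ⟨hl, ?_, ?_, ?_⟩, ?_⟩
  · intro s t hst
    have : (t - x) % l = (s - x) % l := by
      rw [show t - x = s - x + l by omega, Int.add_emod_right]
    simp only [this]
  · intro s t h1 h2
    have bs := hbd s
    have bt := hbd t
    rcases hrem s t h1 h2 with e | e
    · exact hne _ _ (by omega) (by omega) (by omega)
    · exact (hne _ _ (by omega) (by omega) (by omega)).symm
  · intro s t h1 h2
    have bs := hbd s
    have bt := hbd t
    rcases hrem s t h1 h2 with e | e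
    · rw [hadj _ _ (by omega) (by omega) (by omega)]
      omega
    · rw [G.adj_comm, hadj _ _ (by omega) (by omega) (by omega)]
      omega
  · intro t h1 h2
    have : (t - x) % l = t - x := Int.emod_eq_of_lt (by omega) (by omega)
    simp only [this, add_sub_cancel]

/-- Closing up an arc of a hole by an induced path yields a hole. -/
lemma splice (hc : CyclicHole G n c) {q : ℤ → V} {x y l : ℤ} (hl : 4 ≤ l)
    (hxy : x ≤ y) (hyn : y ≤ x + n - 2) (hyl : y + 1 < x + l)
    (hq : InducedOn G q (y + 1) (x + l - 1))
    (hoff : ∀ s t, y + 1 ≤ s → s < x + l → x ≤ t → t ≤ y → q s ≠ c t)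
    (hadj : ∀ s t, y + 1 ≤ s → s < x + l → x ≤ t → t ≤ y →
      (G.Adj (q s) (c t) ↔ s = y + 1 ∧ t = y ∨ s = x + l - 1 ∧ t = x)) :
    ∃ g, CyclicHole G l g ∧ (∀ t, x ≤ t → t ≤ y → g t = c t) ∧
      ∀ t, y + 1 ≤ t → t < x + l → g t = q t := by
  set h : ℤ → V := fun t => if t ≤ y then c t else q t with hh
  have hc' : ∀ t, t ≤ y → h t = c t := fun t ht => if_pos ht
  have hq' : ∀ t, y < t → h t = q t := fun t ht => if_neg (by omega)
  have hne : ∀ s t, x ≤ s → s < t → t < x + l → h s ≠ h t := by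
    intro s t h1 h2 h3
    by_cases hs : s ≤ y <;> by_cases ht : t ≤ y
    · rw [hc' s hs, hc' t ht]
      exact hc.ne _ _ h2 (by omega)
    · rw [hc' s hs, hq' t (by omega)]
      exact (hoff _ _ (by omega) h3 h1 hs).symm
    · omega
    · rw [hq' s (by omega), hq' t (by omega)]
      exact (hq _ _ (by omega) h2 (by omega)).1
  have hhadj : ∀ s t, x ≤ s → s < t → t < x + l →
      (G.Adj (h s) (h t) ↔ t = s + 1 ∨ t = s + l - 1) := by
    intro s t h1 h2 h3
    by_cases hs : s ≤ y <;> by_cases ht : t ≤ y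
    · rw [hc' s hs, hc' t ht, hc.adj_iff _ _ h2 (by omega)]
      omega
    · rw [hc' s hs, hq' t (by omega), G.adj_comm, hadj _ _ (by omega) h3 h1 hs]
      omega
    · omega
    · rw [hq' s (by omega), hq' t (by omega), (hq _ _ (by omega) h2 (by omega)).2]
      omega
  obtain ⟨g, hg, hgt⟩ := exists_of_window hl hne hhadj
  exact ⟨g, hg, fun t h1 h2 => (hgt t h1 (by omega)).trans (hc' t h2),
    fun t h1 h2 => (hgt t (by omega) h2).trans (hq' t (by omega))⟩

end CyclicHole

namespace InducedOn

variable {G : SimpleGraph V} {p : ℤ → V} {a b : ℤ}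

lemma mono (h : InducedOn G p a b) {a' b' : ℤ} (ha : a ≤ a') (hb : b' ≤ b) :
    InducedOn G p a' b' :=
  fun s t h1 h2 h3 => h s t (by omega) h2 (by omega)

lemma shift (h : InducedOn G p a b) (d a' b' : ℤ) (ha : a ≤ a' + d) (hb : b' + d ≤ b) :
    InducedOn G (fun t => p (t + d)) a' b' := by
  intro s t h1 h2 h3
  have := h (s + d) (t + d) (by omega) (by omega) (by omega)
  refine ⟨this.1, this.2.trans (by omega)⟩

lemma reflect (h : InducedOn G p a b) (d a' b' : ℤ) (ha : a ≤ d - b') (hb : d - a' ≤ b) :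
    InducedOn G (fun t => p (d - t)) a' b' := by
  intro s t h1 h2 h3
  have := h (d - t) (d - s) (by omega) (by omega) (by omega)
  refine ⟨this.1.symm, ?_⟩
  rw [G.adj_comm]
  exact this.2.trans (by omega)

lemma adj_iff (h : InducedOn G p a b) {s t : ℤ} (hs : a ≤ s) (hs' : s ≤ b) (ht : a ≤ t)
    (ht' : t ≤ b) : G.Adj (p s) (p t) ↔ t = s + 1 ∨ s = t + 1 := by
  rcases lt_trichotomy s t with hst | rfl | hst
  · rw [(h s t hs hst ht').2]
    omega
  · simp
  · rw [G.adj_comm, (h t s ht hst hs').2]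
    omega

lemma ne (h : InducedOn G p a b) {s t : ℤ} (hs : a ≤ s) (hs' : s ≤ b) (ht : a ≤ t)
    (ht' : t ≤ b) (hst : s ≠ t) : p s ≠ p t := by
  rcases lt_or_gt_of_ne hst with hst | hst
  · exact (h s t hs hst ht').1
  · exact (h t s ht hst hs').1.symm

end InducedOn

namespace ShortestOddCyclicHole

variable {G : SimpleGraph V} {n : ℤ} {c : ℤ → V}

lemma shift (hc : ShortestOddCyclicHole G n c) (a : ℤ) :
    ShortestOddCyclicHole G n (fun t => c (t + a)) :=
  ⟨hc.hole.shift a, hc.odd, hc.le⟩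

lemma reflect (hc : ShortestOddCyclicHole G n c) (a : ℤ) :
    ShortestOddCyclicHole G n (fun t => c (a - t)) :=
  ⟨hc.hole.reflect a, hc.odd, hc.le⟩

end ShortestOddCyclicHole

namespace IsMinor

variable {G : SimpleGraph V} {n : ℤ} {c : ℤ → V} {w : V}

lemma shift (h : IsMinor G n c w) (a : ℤ) : IsMinor G n (fun t => c (t + a)) w := by
  obtain ⟨z, hz⟩ := h
  refine ⟨z - a, fun t h1 h2 h3 => ?_⟩
  have := hz (t + a) (by omega) (by omega) h3
  omega

lemma reflect (hc : CyclicHole G n c) (h : IsMinor G n c w) (a : ℤ) :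
    IsMinor G n (fun t => c (a - t)) w := by
  obtain ⟨z, hz⟩ := h
  refine ⟨a - (z + 2), fun t h1 h2 h3 => ?_⟩
  by_contra hcon
  have := hz (a - t + n) (by omega) (by omega) (by rw [hc.add_period]; exact h3)
  omega

/-- Two neighbours of a minor vertex are within distance two along the hole. -/
lemma close (hc : CyclicHole G n c) (h : IsMinor G n c w) {x y : ℤ}
    (hx : G.Adj w (c x)) (hy : G.Adj w (c y)) :
    (y - x ≤ 2 ∧ x - y ≤ 2) ∨ n - (y - x) ≤ 2 ∨ n - (x - y) ≤ 2 := by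
  obtain ⟨z, hz⟩ := h
  have hn := hc.four_le
  obtain ⟨e, he, e1, e2⟩ := hc.exists_period z x
  have hx' := hz _ e1 e2 (by rwa [he])
  have hy' : ∀ d, c (y + e + d) = c y → z ≤ y + e + d → y + e + d < z + n →
      y + e + d ≤ z + 2 :=
    fun d hd h3 h4 => hz _ h3 h4 (by rwa [hd])
  have d0 := hy' 0 (by rw [add_zero, he])
  have d1 := hy' n (by rw [hc.add_period, he])
  have d2 := hy' (-n) (by rw [← sub_eq_add_neg, hc.sub_period, he])
  omega

/-- Among three neighbours of a minor vertex, two consecutive ones are separated by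
an arc of length at least `n - 2`. -/
lemma gap (hc : CyclicHole G n c) (h : IsMinor G n c w) {x y t : ℤ}
    (hx : G.Adj w (c x)) (hy : G.Adj w (c y)) (ht : G.Adj w (c t))
    (h1 : x < y) (h2 : y < t) (h3 : t < x + n) :
    n - 2 ≤ y - x ∨ n - 2 ≤ t - y ∨ n - 2 ≤ x + n - t := by
  obtain ⟨z, hz⟩ := h
  have hn := hc.four_le
  obtain ⟨e, he, e1, e2⟩ := hc.exists_period z x
  have hx' := hz _ e1 e2 (by rwa [he])
  have hs : ∀ s, G.Adj w (c s) → ∀ d, c (s + e + d) = c s → z ≤ s + e + d →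
      s + e + d < z + n → s + e + d ≤ z + 2 :=
    fun s hs d hd h3 h4 => hz _ h3 h4 (by rwa [hd])
  have d0 := hs y hy 0 (by rw [add_zero, he])
  have d2 := hs y hy (-n) (by rw [← sub_eq_add_neg, hc.sub_period, he])
  have e0 := hs t ht 0 (by rw [add_zero, he])
  have e2 := hs t ht (-n) (by rw [← sub_eq_add_neg, hc.sub_period, he])
  omega

end IsMinor

lemma InducedOn.isInducedPathMap {G : SimpleGraph V} {p : ℤ → V} {a b : ℤ}
    (h : InducedOn G p a b) (k : ℕ) (hk : a + k ≤ b) :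
    IsInducedPathMap G k (fun i : Fin (k + 1) => p (a + (i : ℕ))) := by
  constructor
  · intro i j hij
    by_contra hne
    have := i.isLt
    have := j.isLt
    have := Fin.val_ne_of_ne hne
    exact h.ne (by omega) (by omega) (by omega) (by omega) (by omega) hij
  · intro i j
    have := i.isLt
    have := j.isLt
    rw [h.adj_iff (by omega) (by omega) (by omega) (by omega)]
    omega

/-- Prepending a vertex to an induced path. -/
lemma InducedOn.cons {G : SimpleGraph V} {p q : ℤ → V} {b : ℤ} (h : InducedOn G p 1 b)
    (hq : ∀ t, 1 ≤ t → t ≤ b → q t = p t)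
    (h0 : ∀ t, 1 ≤ t → t ≤ b → q 0 ≠ p t ∧ (G.Adj (q 0) (p t) ↔ t = 1)) :
    InducedOn G q 0 b := by
  intro s t h1 h2 h3
  rw [hq t (by omega) h3]
  rcases h1.eq_or_lt with rfl | h1
  · exact h0 t (by omega) h3
  · rw [hq s (by omega) (by omega)]
    exact h s t (by omega) h2 h3

/-- Three induced paths from a common apex to a triangle form a pyramid. -/
lemma containsPyramid_of_paths {G : SimpleGraph V} {q₁ q₂ q₃ : ℤ → V} {k₁ k₂ k₃ : ℤ}
    (hk₁ : 1 ≤ k₁) (hk₂ : 1 ≤ k₂) (hk₃ : 1 ≤ k₃)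
    (hk : (2 ≤ k₁ ∧ 2 ≤ k₂) ∨ (2 ≤ k₁ ∧ 2 ≤ k₃) ∨ (2 ≤ k₂ ∧ 2 ≤ k₃))
    (h₁ : InducedOn G q₁ 0 k₁) (h₂ : InducedOn G q₂ 0 k₂) (h₃ : InducedOn G q₃ 0 k₃)
    (h0₂ : q₂ 0 = q₁ 0) (h0₃ : q₃ 0 = q₁ 0)
    (h₁₂ : ∀ s t, 1 ≤ s → s ≤ k₁ → 1 ≤ t → t ≤ k₂ →
      q₁ s ≠ q₂ t ∧ (G.Adj (q₁ s) (q₂ t) ↔ s = k₁ ∧ t = k₂))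
    (h₁₃ : ∀ s t, 1 ≤ s → s ≤ k₁ → 1 ≤ t → t ≤ k₃ →
      q₁ s ≠ q₃ t ∧ (G.Adj (q₁ s) (q₃ t) ↔ s = k₁ ∧ t = k₃))
    (h₂₃ : ∀ s t, 1 ≤ s → s ≤ k₂ → 1 ≤ t → t ≤ k₃ →
      q₂ s ≠ q₃ t ∧ (G.Adj (q₂ s) (q₃ t) ↔ s = k₂ ∧ t = k₃)) :
    ContainsPyramid G := by
  have last : ∀ (q : ℤ → V) (k : ℕ),
      (fun i : Fin (k + 1) => q (0 + (i : ℕ))) (Fin.last k) = q k := by simp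
  have tip : ∀ (q : ℤ → V) (k : ℕ), (fun i : Fin (k + 1) => q (0 + (i : ℕ))) 0 = q 0 := by simp
  have mem : ∀ (q : ℤ → V) (k : ℕ) (u : V),
      u ∈ Set.range (fun i : Fin (k + 1) => q (0 + (i : ℕ))) →
      u = q 0 ∨ ∃ s : ℤ, 1 ≤ s ∧ s ≤ k ∧ u = q s := by
    rintro q k _ ⟨i, rfl⟩
    have := i.isLt
    by_cases hi : (i : ℕ) = 0
    · left; simp [hi]
    · right; exact ⟨i, by omega, by omega, by simp⟩
  have meet : ∀ (q q' : ℤ → V) (k k' : ℕ), q' 0 = q 0 →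
      (∀ s t : ℤ, 1 ≤ s → s ≤ k → 1 ≤ t → t ≤ k' →
        q s ≠ q' t ∧ (G.Adj (q s) (q' t) ↔ s = k ∧ t = k')) →
      (Set.range (fun i : Fin (k + 1) => q (0 + (i : ℕ))) ∩
        Set.range (fun i : Fin (k' + 1) => q' (0 + (i : ℕ))) ⊆ {q 0}) ∧
      ∀ u w : V, u ∈ Set.range (fun i : Fin (k + 1) => q (0 + (i : ℕ))) →
        w ∈ Set.range (fun i : Fin (k' + 1) => q' (0 + (i : ℕ))) → u ≠ q 0 → w ≠ q 0 →
        G.Adj u w → u = q k ∧ w = q' k' := by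
    intro q q' k k' h0 h
    constructor
    · rintro u ⟨hu, hu'⟩
      rcases mem q k u hu with rfl | ⟨s, s1, s2, rfl⟩
      · exact rfl
      · rcases mem q' k' _ hu' with e | ⟨t, t1, t2, e⟩
        · exact e.trans h0
        · exact absurd e (h s t s1 s2 t1 t2).1
    · intro u w hu hw hu0 hw0 huw
      rcases mem q k u hu with rfl | ⟨s, s1, s2, rfl⟩
      · exact absurd rfl hu0
      · rcases mem q' k' _ hw with rfl | ⟨t, t1, t2, rfl⟩
        · exact absurd h0 hw0
        · obtain ⟨rfl, rfl⟩ := (h s t s1 s2 t1 t2).2.1 huw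
          exact ⟨rfl, rfl⟩
  lift k₁ to ℕ using by omega
  lift k₂ to ℕ using by omega
  lift k₃ to ℕ using by omega
  have m₁₂ := meet q₁ q₂ k₁ k₂ h0₂ h₁₂
  have m₁₃ := meet q₁ q₃ k₁ k₃ h0₃ h₁₃
  have m₂₃ := meet q₂ q₃ k₂ k₃ (h0₃.trans h0₂.symm) h₂₃
  rw [h0₂] at m₂₃
  refine ⟨q₁ 0, q₁ k₁, q₂ k₂, q₃ k₃, k₁, k₂, k₃, _, _, _, h₁.isInducedPathMap k₁ (by simp),
    h₂.isInducedPathMap k₂ (by simp), h₃.isInducedPathMap k₃ (by simp), tip _ _,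
    (tip _ _).trans h0₂, (tip _ _).trans h0₃, last _ _, last _ _, last _ _, ?_, ?_, ?_,
    ?_, ?_, ?_, by omega, m₁₂.1, m₁₃.1, m₂₃.1, m₁₂.2, m₁₃.2, m₂₃.2⟩
  · exact h₁.ne (by omega) (by omega) (by omega) (by omega) (by omega)
  · rw [← h0₂]
    exact h₂.ne (by omega) (by omega) (by omega) (by omega) (by omega)
  · rw [← h0₃]
    exact h₃.ne (by omega) (by omega) (by omega) (by omega) (by omega)
  · exact (h₁₂ _ _ hk₁ le_rfl hk₂ le_rfl).2.2 ⟨rfl, rfl⟩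
  · exact (h₁₃ _ _ hk₁ le_rfl hk₃ le_rfl).2.2 ⟨rfl, rfl⟩
  · exact (h₂₃ _ _ hk₂ le_rfl hk₃ le_rfl).2.2 ⟨rfl, rfl⟩

namespace CyclicHole

variable {G : SimpleGraph V} {n : ℤ} {c : ℤ → V}

lemma inducedOn (hc : CyclicHole G n c) {a b : ℤ} (h : b ≤ a + n - 2) : InducedOn G c a b := by
  intro s t h1 h2 h3
  refine ⟨hc.ne s t h2 (by omega), (hc.adj_iff s t h2 (by omega)).trans (by omega)⟩

/-- A hole together with an induced path joining an edge of the hole to a single vertex of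
the hole contains a pyramid. -/
lemma containsPyramid (hc : CyclicHole G n c) {q : ℤ → V} {s z : ℤ} (hs : 1 ≤ s) (hz : 2 ≤ z)
    (hzn : z ≤ n - 1) (hlen : 2 ≤ s ∨ (3 ≤ z ∧ z ≤ n - 2))
    (hq : InducedOn G q 1 s) (hoff : ∀ i t, 1 ≤ i → i ≤ s → 0 ≤ t → t < n → q i ≠ c t)
    (hadj : ∀ i t, 1 ≤ i → i ≤ s → 0 ≤ t → t < n →
      (G.Adj (q i) (c t) ↔ (i = 1 ∧ (t = 0 ∨ t = 1)) ∨ (i = s ∧ t = z))) :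
    ContainsPyramid G := by
  have hn := hc.four_le
  have hoff' : ∀ i t, 1 ≤ i → i ≤ s → 1 ≤ t → t ≤ n → q i ≠ c t := by
    intro i t h1 h2 h3 h4
    rcases h4.eq_or_lt with rfl | h4
    · rw [hc.periodic 0 t (by omega)]
      exact hoff i 0 h1 h2 le_rfl (by omega)
    · exact hoff i t h1 h2 (by omega) h4
  have hadj' : ∀ i t, 1 ≤ i → i ≤ s → 1 ≤ t → t ≤ n →
      (G.Adj (q i) (c t) ↔ (i = 1 ∧ (t = n ∨ t = 1)) ∨ (i = s ∧ t = z)) := by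
    intro i t h1 h2 h3 h4
    rcases h4.eq_or_lt with rfl | h4
    · rw [hc.periodic 0 t (by omega), hadj i 0 h1 h2 le_rfl (by omega)]
      omega
    · rw [hadj i t h1 h2 (by omega) h4]
      omega
  refine containsPyramid_of_paths (q₁ := fun i => if i = 0 then c z else q (s + 1 - i))
    (q₂ := fun i => c (z - i)) (q₃ := fun i => c (z + i)) (k₁ := s) (k₂ := z - 1) (k₃ := n - z)
    hs (by omega) (by omega) (by omega) ?_ ?_ ?_ (by simp) (by simp) ?_ ?_ ?_
  · refine InducedOn.cons (hq.reflect (s + 1) 1 s (by omega) (by omega)) ?_ ?_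
    · intro t h1 h2
      rw [if_neg (by omega)]
    · intro t h1 h2
      simp only [if_true]
      refine ⟨(hoff' _ _ (by omega) (by omega) (by omega) (by omega)).symm, ?_⟩
      rw [G.adj_comm, hadj' _ _ (by omega) (by omega) (by omega) (by omega)]
      omega
  · exact (hc.inducedOn (a := 1) (b := z) (by omega)).reflect z 0 _ (by omega) (by omega)
  · have := (hc.inducedOn (a := z) (b := n) (by omega)).shift z 0 (n - z) (by omega) (by omega)
    simpa only [add_comm] using this
  · intro i t h1 h2 h3 h4
    simp only [if_neg (show i ≠ 0 by omega)]
    refine ⟨hoff' _ _ (by omega) (by omega) (by omega) (by omega), ?_⟩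
    rw [hadj' _ _ (by omega) (by omega) (by omega) (by omega)]
    omega
  · intro i t h1 h2 h3 h4
    simp only [if_neg (show i ≠ 0 by omega)]
    refine ⟨hoff' _ _ (by omega) (by omega) (by omega) (by omega), ?_⟩
    rw [hadj' _ _ (by omega) (by omega) (by omega) (by omega)]
    omega
  · intro i t h1 h2 h3 h4
    refine ⟨hc.ne _ _ (by omega) (by omega), ?_⟩
    rw [hc.adj_iff _ _ (by omega) (by omega)]
    omega

/-- A vertex outside the hole whose neighbours on the hole lie among four consecutive vertices
and include the first and the last of these yields a jewel. -/
lemma containsJewel (hc : CyclicHole G n c) (hn : 5 ≤ n) {w : V} {z : ℤ}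
    (hoff : ∀ t, w ≠ c t) (h0 : G.Adj w (c z)) (h3 : G.Adj w (c (z + 3)))
    (h : ∀ t, z ≤ t → t < z + n → G.Adj w (c t) → t ≤ z + 3) : ContainsJewel G := by
  have hpath := ((hc.inducedOn (a := z + 3) (b := z + n) (by omega)).reflect (z + n) 0 (n - 3)
    (by omega) (by omega)).isInducedPathMap (n - 3).toNat (by omega)
  refine ⟨c z, c (z + 1), c (z + 2), c (z + 3), w, (n - 3).toNat, _, ?_, ?_, ?_, ?_, h3.symm, h0,
    ?_, ?_, ?_, hpath, ?_, ?_, ?_⟩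
  · simp only [List.pairwise_cons, List.mem_cons, List.not_mem_nil, or_false, forall_eq_or_imp,
      forall_eq, List.Pairwise.nil, IsEmpty.forall_iff, implies_true, and_true]
    refine ⟨⟨?_, ?_, ?_, (hoff _).symm⟩, ⟨?_, ?_, (hoff _).symm⟩, ⟨?_, (hoff _).symm⟩,
      (hoff _).symm⟩ <;> exact hc.ne _ _ (by omega) (by omega)
  · rw [hc.adj_iff _ _ (by omega) (by omega)]; omega
  · rw [hc.adj_iff _ _ (by omega) (by omega)]; omega
  · rw [hc.adj_iff _ _ (by omega) (by omega)]; omega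
  · rw [hc.adj_iff _ _ (by omega) (by omega)]; omega
  · rw [hc.adj_iff _ _ (by omega) (by omega)]; omega
  · rw [hc.adj_iff _ _ (by omega) (by omega)]; omega
  · simp [hc.add_period]
  · simp only [Fin.val_last]
    congr 1
    omega
  · intro i hi hi'
    have := i.isLt
    have h1 : (i : ℕ) ≠ 0 := fun e => hi (Fin.ext e)
    have h2 : (i : ℕ) ≠ (n - 3).toNat := fun e => hi' (Fin.ext e)
    refine ⟨?_, ?_, fun hw => ?_⟩
    · rw [hc.adj_iff _ _ (by omega) (by omega)]; omega
    · rw [hc.adj_iff _ _ (by omega) (by omega)]; omega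
    · have := h _ (by omega) (by omega) hw
      omega

/-- In a graph without jewels, four consecutive vertices can be replaced by three in the
definition of a minor vertex. -/
lemma isMinor_of_four (hJ : ¬ ContainsJewel G) (hc : CyclicHole G n c) (hn : 5 ≤ n) {w : V}
    (hoff : ∀ t, w ≠ c t) {x z : ℤ} (hz : x - n ≤ z) (hz' : z < x + n)
    (h : ∀ t, x ≤ t → t < x + n → G.Adj w (c t) →
      (z ≤ t ∧ t ≤ z + 3) ∨ (z ≤ t + n ∧ t + n ≤ z + 3) ∨ (z ≤ t - n ∧ t - n ≤ z + 3)) :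
    IsMinor G n c w := by
  have key : ∀ t, z ≤ t → t < z + n → G.Adj w (c t) → t ≤ z + 3 := by
    intro t h1 h2 h3
    rcases lt_or_ge t x with h4 | h4
    · have := h (t + n) (by omega) (by omega) (by rwa [hc.add_period])
      omega
    · rcases lt_or_ge t (x + n) with h5 | h5
      · have := h t (by omega) (by omega) h3
        omega
      · have := h (t - n) (by omega) (by omega) (by rwa [hc.sub_period])
        omega
  by_cases h0 : G.Adj w (c z)
  · by_cases h3 : G.Adj w (c (z + 3))
    · exact absurd (hc.containsJewel hn hoff h0 h3 key) hJ
    · refine ⟨z, fun t h1 h2 h4 => ?_⟩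
      have := key t h1 h2 h4
      have : t ≠ z + 3 := by rintro rfl; exact h3 h4
      omega
  · refine ⟨z + 1, fun t h1 h2 h4 => ?_⟩
    by_contra hcon
    rcases lt_or_ge t (z + n) with h5 | h5
    · have := key t (by omega) h5 h4
      omega
    · apply h0
      rwa [← hc.periodic z t (by omega)]

end CyclicHole

/-- A walk of length `m` through minor vertices joins two vertices of a shortest odd hole only
if these are at distance at most `m` along the hole. -/
def ArcBound (G : SimpleGraph V) (m : ℤ) : Prop :=
  ∀ (n : ℤ) (c : ℤ → V), ShortestOddCyclicHole G n c → ∀ (p : ℤ → V) (a b x y : ℤ), b = a + m →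
    (∀ i, a ≤ i → i < b → G.Adj (p i) (p (i + 1))) → p a = c x → p b = c y →
    (∀ i, a < i → i < b → IsMinor G n c (p i)) →
    (y - x ≤ m ∧ x - y ≤ m) ∨ n - (y - x) ≤ m ∨ n - (x - y) ≤ m

/-- An induced path with minor interior outside a shortest odd hole, joining two vertices of
the hole, where the distance bound is known for shorter walks. -/
structure Detour (G : SimpleGraph V) (n : ℤ) (c : ℤ → V) (m K : ℤ) (p : ℤ → V) : Prop where
  hole : ShortestOddCyclicHole G n c
  three_le : 3 ≤ m
  path : InducedOn G p 0 m
  first : p 0 = c 0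
  last : p m = c K
  pos : 0 < K
  lt : K < n
  off : ∀ i t, 0 < i → i < m → p i ≠ c t
  minor : ∀ i, 0 < i → i < m → IsMinor G n c (p i)
  bound : ∀ l, 0 ≤ l → l < m → ArcBound G l

/-- The neighbours of `w` on the cycle `c`, spread around the index `k`, reach from `k - ν`
to `k + α`. -/
structure Span (G : SimpleGraph V) (n : ℤ) (c : ℤ → V) (w : V) (k α ν : ℤ) : Prop where
  nonneg : 0 ≤ α
  nonneg' : 0 ≤ ν
  add_le : α + ν ≤ 2
  adj : G.Adj w (c (k + α))
  adj' : G.Adj w (c (k - ν))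
  eq : ∀ t, k + α ≤ t → t ≤ k - ν + n → G.Adj w (c t) → t = k + α ∨ t = k - ν + n

lemma Span.reflect {G : SimpleGraph V} {n : ℤ} {c : ℤ → V} (hc : CyclicHole G n c) {w : V}
    {k α ν : ℤ} (h : Span G n c w k α ν) (a b : ℤ) (hb : b = a - k) :
    Span G n (fun t => c (a - t)) w b ν α := by
  subst hb
  refine ⟨h.nonneg', h.nonneg, by have := h.add_le; omega, ?_, ?_, ?_⟩
  · convert h.adj' using 2
    omega
  · convert h.adj using 2
    omega
  · intro t h1 h2 h3
    have := h.eq (a - t + n) (by omega) (by omega) (by rw [hc.add_period]; exact h3)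
    omega

lemma IsMinor.exists_span {G : SimpleGraph V} {n : ℤ} {c : ℤ → V} (hc : CyclicHole G n c)
    (hn : 7 ≤ n) {w : V} (hw : IsMinor G n c w) {k : ℤ} (hk : G.Adj w (c k)) :
    ∃ α ν, Span G n c w k α ν := by
  have near : ∀ x y, G.Adj w (c x) → G.Adj w (c y) →
      (y - x ≤ 2 ∧ x - y ≤ 2) ∨ n - (y - x) ≤ 2 ∨ n - (x - y) ≤ 2 :=
    fun x y hx hy => hw.close hc hx hy
  obtain ⟨α, hα0, hα2, hα, hα'⟩ : ∃ α, 0 ≤ α ∧ α ≤ 2 ∧ G.Adj w (c (k + α)) ∧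
      ∀ t, k + α < t → t ≤ k + 2 → ¬ G.Adj w (c t) := by
    by_cases h2 : G.Adj w (c (k + 2))
    · exact ⟨2, by omega, by omega, h2, fun t _ _ => by omega⟩
    · by_cases h1 : G.Adj w (c (k + 1))
      · refine ⟨1, by omega, by omega, h1, fun t h3 h4 => ?_⟩
        rwa [show t = k + 2 by omega]
      · refine ⟨0, by omega, by omega, by rwa [add_zero], fun t h3 h4 => ?_⟩
        obtain rfl | rfl : t = k + 1 ∨ t = k + 2 := by omega
        exacts [h1, h2]
  obtain ⟨ν, hν0, hν2, hν, hν'⟩ : ∃ ν, 0 ≤ ν ∧ ν ≤ 2 ∧ G.Adj w (c (k - ν)) ∧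
      ∀ t, k - 2 ≤ t → t < k - ν → ¬ G.Adj w (c t) := by
    by_cases h2 : G.Adj w (c (k - 2))
    · exact ⟨2, by omega, by omega, h2, fun t _ _ => by omega⟩
    · by_cases h1 : G.Adj w (c (k - 1))
      · refine ⟨1, by omega, by omega, h1, fun t h3 h4 => ?_⟩
        rwa [show t = k - 2 by omega]
      · refine ⟨0, by omega, by omega, by rwa [sub_zero], fun t h3 h4 => ?_⟩
        obtain rfl | rfl : t = k - 1 ∨ t = k - 2 := by omega
        exacts [h1, h2]
  refine ⟨α, ν, hα0, hν0, by have := near _ _ hα hν; omega, hα, hν, fun t h1 h2 h3 => ?_⟩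
  have h4 := near _ _ hk h3
  have h5 : ¬ (k + α < t ∧ t ≤ k + 2) := fun h => hα' t h.1 h.2 h3
  have h6 : ¬ (k - 2 ≤ t - n ∧ t - n < k - ν) :=
    fun h => hν' (t - n) h.1 h.2 (by rwa [hc.sub_period])
  omega

/-- Closing up an arc of a shortest odd hole cannot produce a shorter odd hole. -/
lemma ShortestOddCyclicHole.false_of_splice {G : SimpleGraph V} {n : ℤ} {c : ℤ → V}
    (hc : ShortestOddCyclicHole G n c) {q : ℤ → V} {x y l : ℤ} (hl : 4 ≤ l) (hln : l < n)
    (hodd : Odd l) (hxy : x ≤ y) (hyn : y ≤ x + n - 2) (hyl : y + 1 < x + l)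
    (hq : InducedOn G q (y + 1) (x + l - 1))
    (hoff : ∀ s t, y + 1 ≤ s → s < x + l → x ≤ t → t ≤ y → q s ≠ c t)
    (hadj : ∀ s t, y + 1 ≤ s → s < x + l → x ≤ t → t ≤ y →
      (G.Adj (q s) (c t) ↔ s = y + 1 ∧ t = y ∨ s = x + l - 1 ∧ t = x)) : False := by
  obtain ⟨g, hg, -⟩ := hc.hole.splice hl hxy hyn hyl hq hoff hadj
  have := hc.le l g hg hodd
  omega

namespace Detour

variable {G : SimpleGraph V} {n m K : ℤ} {c p : ℤ → V}

lemma reverse (hd : Detour G n c m K p) :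
    Detour G n (fun t => c (K - t)) m K (fun i => p (m - i)) where
  hole := hd.hole.reflect K
  three_le := hd.three_le
  path := hd.path.reflect m 0 m (by omega) (by omega)
  first := by simpa using hd.last
  last := by simpa using hd.first
  pos := hd.pos
  lt := hd.lt
  off i t h1 h2 := hd.off _ _ (by omega) (by omega)
  minor i h1 h2 := (hd.minor _ (by omega) (by omega)).reflect hd.hole.hole K
  bound := hd.bound

lemma rung_first (hd : Detour G n c m K p) : G.Adj (p 1) (c 0) := by
  have := hd.three_le
  rw [← hd.first, hd.path.adj_iff (by omega) (by omega) (by omega) (by omega)]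
  omega

lemma rung_last (hd : Detour G n c m K p) : G.Adj (p (m - 1)) (c K) := by
  have := hd.three_le
  rw [← hd.last, hd.path.adj_iff (by omega) (by omega) (by omega) (by omega)]
  omega

/-- Rungs of a detour do not make shortcuts. -/
lemma compat (hd : Detour G n c m K p) {i j x y : ℤ} (hi : 0 < i) (hij : i ≤ j) (hj : j < m)
    (hlen : i = j ∨ j - i + 2 < m) (hx : G.Adj (p i) (c x)) (hy : G.Adj (p j) (c y)) :
    (y - x ≤ j - i + 2 ∧ x - y ≤ j - i + 2) ∨ n - (y - x) ≤ j - i + 2 ∨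
      n - (x - y) ≤ j - i + 2 := by
  rcases hlen with rfl | hlen
  · have := (hd.minor i hi hj).close hd.hole.hole hx hy
    omega
  · obtain ⟨w, hp, h0, h1⟩ : ∃ w : ℤ → V, (∀ t, i ≤ t → t ≤ j → w t = p t) ∧
        w (i - 1) = c x ∧ w (j + 1) = c y := by
      refine ⟨fun t => if t < i then c x else if j < t then c y else p t, fun t h1 h2 => ?_,
        if_pos (by omega), ?_⟩
      · simp only [if_neg (show ¬ t < i by omega), if_neg (show ¬ j < t by omega)]
      · simp only [if_neg (show ¬ j + 1 < i by omega), if_pos (show j < j + 1 by omega)]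
    refine hd.bound (j - i + 2) (by omega) hlen n c hd.hole w (i - 1) (j + 1) x y (by omega)
      ?_ h0 h1 ?_
    · intro t h2 h3
      rcases h2.eq_or_lt with rfl | h2
      · rw [h0, hp (i - 1 + 1) (by omega) (by omega), sub_add_cancel]
        exact hx.symm
      · rw [hp t (by omega) (by omega)]
        rcases (show t ≤ j by omega).eq_or_lt with rfl | h4
        · rw [h1]
          exact hy
        · rw [hp (t + 1) (by omega) (by omega),
            hd.path.adj_iff (by omega) (by omega) (by omega) (by omega)]
          omega
    · intro t h2 h3
      rw [hp t (by omega) (by omega)]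
      exact hd.minor t (by omega) (by omega)

lemma false_of_span_add_eq_one (hP : ¬ ContainsPyramid G) (hd : Detour G n c m K p)
    (hmid : ∀ i t, 2 ≤ i → i ≤ m - 2 → ¬ G.Adj (p i) (c t)) {α ν α' ν' : ℤ}
    (hA : Span G n c (p 1) 0 α ν) (hB : Span G n c (p (m - 1)) K ν' α')
    (h1 : 1 ≤ K - α - α') (h2 : 1 ≤ n - K - ν - ν') (hw : α + ν = 1)
    (hw' : α' + ν' = 0 ∨ α' + ν' = 2) : False := by
  have hc := hd.hole.hole
  have hn := hc.four_le
  have hm := hd.three_le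
  have hA0 := hA.nonneg
  have hA0' := hA.nonneg'
  have hB0 := hB.nonneg
  have hB0' := hB.nonneg'
  have first : ∀ u, -ν ≤ u → u < n - ν → (G.Adj (p 1) (c u) ↔ u = -ν ∨ u = α) := by
    intro u u1 u2
    constructor
    · intro hu
      have := hA.eq u
      have : 0 + α ≤ u → u = α := fun h => by
        have := this h (by omega) hu
        omega
      omega
    · rintro (rfl | rfl)
      · simpa using hA.adj'
      · simpa using hA.adj
  rcases hw' with hw' | hw'
  · obtain rfl : α' = 0 := by omega
    obtain rfl : ν' = 0 := by omega
    have last : ∀ u, -ν ≤ u → u < n - ν → (G.Adj (p (m - 1)) (c u) ↔ u = K) := by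
      intro u u1 u2
      constructor
      · intro hu
        by_contra hne
        rcases lt_or_ge u K with h | h
        · have := hB.eq (u + n) (by omega) (by omega) (by rwa [hc.add_period])
          omega
        · have := hB.eq u (by omega) (by omega) hu
          omega
      · rintro rfl
        exact hd.rung_last
    refine hP ((hc.shift (-ν)).containsPyramid (q := p) (s := m - 1) (z := K + ν) (by omega)
      (by omega) (by omega) (by omega) (hd.path.mono (by omega) (by omega))
      (fun i t _ _ _ _ => hd.off _ _ (by omega) (by omega)) ?_)
    intro i t i1 i2 t1 t2
    by_cases hi1 : i = 1
    · subst hi1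
      rw [first _ (by omega) (by omega)]
      omega
    · by_cases him : i = m - 1
      · subst him
        rw [last _ (by omega) (by omega)]
        omega
      · have := hmid i (t + -ν) (by omega) (by omega)
        simp only [this, false_iff]
        omega
  · obtain ⟨g, hg, hgc, hgp⟩ := hc.splice (q := fun _ => p (m - 1)) (x := K + ν')
      (y := n + K - α') (l := n) (by omega) (by omega) (by omega) (by omega)
      (fun s t _ _ _ => by omega) (fun s t _ _ _ _ => hd.off _ _ (by omega) (by omega)) (by
        intro s t s1 s2 t1 t2
        constructor
        · intro ht
          have := hB.eq t (by omega) (by omega) ht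
          omega
        · rintro (⟨-, rfl⟩ | ⟨-, rfl⟩)
          · rw [show n + K - α' = K - α' + n by ring, hc.add_period]
            exact hB.adj'
          · exact hB.adj)
    have gc : ∀ u, -ν ≤ u → u < n - ν → u ≠ K - α' + 1 → g u = c u := by
      intro u u1 u2 u3
      rcases lt_or_ge u (K + ν') with h | h
      · rw [← hg.add_period, hgc _ (by omega) (by omega), hc.add_period]
      · exact hgc _ h (by omega)
    have gp : g (K - α' + 1) = p (m - 1) := by
      rw [← hg.add_period]
      exact hgp _ (by omega) (by omega)
    refine hP ((hg.shift (-ν)).containsPyramid (q := p) (s := m - 2) (z := K - α' + 1 + ν)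
      (by omega) (by omega) (by omega) (by omega) (hd.path.mono (by omega) (by omega)) ?_ ?_)
    · intro i t i1 i2 t1 t2
      by_cases ht : t + -ν = K - α' + 1
      · simp only [ht, gp]
        exact hd.path.ne (by omega) (by omega) (by omega) (by omega) (by omega)
      · rw [gc _ (by omega) (by omega) ht]
        exact hd.off _ _ (by omega) (by omega)
    · intro i t i1 i2 t1 t2
      by_cases ht : t + -ν = K - α' + 1
      · simp only [ht, gp]
        rw [hd.path.adj_iff (by omega) (by omega) (by omega) (by omega)]
        omega
      · rw [gc _ (by omega) (by omega) ht]
        by_cases hi1 : i = 1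
        · subst hi1
          rw [first _ (by omega) (by omega)]
          omega
        · have := hmid i (t + -ν) (by omega) (by omega)
          simp only [this, false_iff]
          omega

/-- A detour without middle rungs which is short compared with both arcs of the hole cannot
exist. -/
lemma false_of_no_middle_rung (hP : ¬ ContainsPyramid G) (hd : Detour G n c m K p)
    (hmid : ∀ i t, 2 ≤ i → i ≤ m - 2 → ¬ G.Adj (p i) (c t)) {α ν α' ν' : ℤ}
    (hA : Span G n c (p 1) 0 α ν) (hB : Span G n c (p (m - 1)) K ν' α')
    (h1 : 1 ≤ K - α - α') (h2 : 1 ≤ n - K - ν - ν') (h3 : K - α - α' + m < n)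
    (h4 : n - K - ν - ν' + m < n) : False := by
  have hc := hd.hole.hole
  have hm := hd.three_le
  have hA0 := hA.nonneg
  have hA0' := hA.nonneg'
  have hA2 := hA.add_le
  have hB0 := hB.nonneg
  have hB0' := hB.nonneg'
  have hB2 := hB.add_le
  have even1 : ¬ Odd (K - α - α' + m) := by
    intro hodd
    refine hd.hole.false_of_splice (q := fun s => p (m + K - α' - s)) (x := α) (y := K - α')
      (by omega) h3 hodd (by omega) (by omega) (by omega)
      (hd.path.reflect (m + K - α') _ _ (by omega) (by omega))
      (fun s t _ _ _ _ => hd.off _ _ (by omega) (by omega)) ?_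
    intro s t s1 s2 t1 t2
    constructor
    · intro ht
      by_cases e1 : s = K - α' + 1
      · have := hB.eq (t + n) (by omega) (by omega) (by
          rw [hc.add_period]; convert ht using 2; omega)
        omega
      · by_cases e2 : s = α + (K - α - α' + m) - 1
        · have := hA.eq t (by omega) (by omega) (by convert ht using 2; omega)
          omega
        · exact absurd ht (hmid _ _ (by omega) (by omega))
    · rintro (⟨rfl, rfl⟩ | ⟨rfl, rfl⟩)
      · convert hB.adj' using 2
        omega
      · convert hA.adj using 2 <;> omega
  have even2 : ¬ Odd (n - K - ν - ν' + m) := by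
    intro hodd
    refine hd.hole.false_of_splice (q := fun s => p (s + (ν - n))) (x := K + ν') (y := n - ν)
      (by omega) h4 hodd (by omega) (by omega) (by omega)
      (hd.path.shift (ν - n) _ _ (by omega) (by omega))
      (fun s t _ _ _ _ => hd.off _ _ (by omega) (by omega)) ?_
    intro s t s1 s2 t1 t2
    constructor
    · intro ht
      by_cases e1 : s = n - ν + 1
      · have := hA.eq t (by omega) (by omega) (by convert ht using 2; omega)
        omega
      · by_cases e2 : s = K + ν' + (n - K - ν - ν' + m) - 1
        · have := hB.eq t (by omega) (by omega) (by convert ht using 2; omega)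
          omega
        · exact absurd ht (hmid _ _ (by omega) (by omega))
    · rintro (⟨rfl, rfl⟩ | ⟨rfl, rfl⟩)
      · rw [show n - ν = 0 - ν + n by ring, hc.add_period]
        convert hA.adj' using 2
        omega
      · convert hB.adj using 2
        omega
  have hodd := hd.hole.odd
  rw [Int.odd_iff] at even1 even2 hodd
  by_cases hw : α + ν = 1
  · exact hd.false_of_span_add_eq_one hP hmid hA hB h1 h2 hw (by omega)
  · refine hd.reverse.false_of_span_add_eq_one hP (α := α') (ν := ν') (α' := α) (ν' := ν)
      (fun i t _ _ => hmid _ _ (by omega) (by omega)) (hB.reflect hc K 0 (by omega)) ?_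
      (by omega) (by omega) (by omega) (by omega)
    have := hA.reflect hc K K (by omega)
    simpa using this

end Detour

/-- Replacing an arc of a shortest odd hole by an initial segment of a path yields another
shortest odd hole; if the rest of the path is minor for it, the distance bound applies. -/
lemma ShortestOddCyclicHole.reroute {G : SimpleGraph V} {n m : ℤ} {c p : ℤ → V}
    (hJ : ¬ ContainsJewel G) (hc : ShortestOddCyclicHole G n c) (hn : 5 ≤ n) {i y k : ℤ}
    (hi : 1 ≤ i) (him : i < m) (hp : InducedOn G p 1 m)
    (hoff : ∀ j t, 0 < j → j < m → p j ≠ c t)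
    (hbound : ArcBound G (m - i)) (hk : y + i + 1 - n ≤ k) (hk' : k ≤ y) (hlast : p m = c k)
    (hattach : ∀ j t, 1 ≤ j → j ≤ i → y + i + 1 - n ≤ t → t ≤ y →
      (G.Adj (p j) (c t) ↔ (j = 1 ∧ t = y) ∨ (j = i ∧ t = y + i + 1 - n)))
    (hminor : ∀ l, i < l → l < m → ∃ z, y + i + 1 - n - n ≤ z ∧ z < y + i + 1 ∧
      ∀ t, y + i + 1 - n ≤ t → t ≤ y + i →
        (t ≤ y ∧ G.Adj (p l) (c t) ∨ t = y + i ∧ l = i + 1) →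
        (z ≤ t ∧ t ≤ z + 3) ∨ (z ≤ t + n ∧ t + n ≤ z + 3) ∨ (z ≤ t - n ∧ t - n ≤ z + 3)) :
    (k - (y + i) ≤ m - i ∧ y + i - k ≤ m - i) ∨ n - (k - (y + i)) ≤ m - i ∨
      n - (y + i - k) ≤ m - i := by
  obtain ⟨g, hg, hgc, hgp⟩ := hc.hole.splice (q := fun s => p (s + -y)) (x := y + i + 1 - n)
    (y := y) (l := n) (by omega) (by omega) (by omega) (by omega)
    (hp.shift (-y) _ _ (by omega) (by omega))
    (fun s t _ _ _ _ => hoff _ _ (by omega) (by omega)) (by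
      intro s t s1 s2 t1 t2
      rw [hattach _ _ (by omega) (by omega) t1 t2]
      omega)
  have hgp' : ∀ t, y + 1 ≤ t → t ≤ y + i → g t = p (t + -y) :=
    fun t t1 t2 => hgp t t1 (by omega)
  refine hbound n g ⟨hg, hc.odd, hc.le⟩ p i m (y + i) k (by omega) ?_ ?_ ?_ ?_
  · intro j j1 j2
    rw [hp.adj_iff (by omega) (by omega) (by omega) (by omega)]
    omega
  · rw [hgp' _ (by omega) (by omega)]
    congr 1
    omega
  · rw [hgc k hk hk', hlast]
  · intro l l1 l2
    obtain ⟨z, z1, z2, hz⟩ := hminor l l1 l2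
    refine hg.isMinor_of_four hJ hn ?_ (x := y + i + 1 - n) (z := z) (by omega) (by omega) ?_
    · intro t
      obtain ⟨e, he, e1, e2⟩ := hg.exists_period (y + i + 1 - n) t
      rw [← he t]
      rcases le_or_gt (t + e) y with h | h
      · rw [hgc _ e1 h]
        exact hoff _ _ (by omega) (by omega)
      · rw [hgp' _ (by omega) (by omega)]
        exact hp.ne (by omega) (by omega) (by omega) (by omega) (by omega)
    · intro t t1 t2 ht
      refine hz t t1 (by omega) ?_
      rcases le_or_gt t y with h | h
      · left
        rw [hgc _ t1 h] at ht
        exact ⟨h, ht⟩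
      · right
        rw [hgp' _ (by omega) (by omega),
          hp.adj_iff (by omega) (by omega) (by omega) (by omega)] at ht
        omega

lemma exists_first {P : ℤ → Prop} {a b : ℤ} (hab : a ≤ b) (hb : P b) :
    ∃ i, a ≤ i ∧ i ≤ b ∧ P i ∧ ∀ j, a ≤ j → j < i → ¬ P j := by
  obtain ⟨i, ⟨h1, h2⟩, h3⟩ := Int.exists_least_of_bdd (P := fun i => a ≤ i ∧ P i)
    ⟨a, fun z hz => hz.1⟩ ⟨b, hab, hb⟩
  exact ⟨i, h1, h3 b ⟨hab, hb⟩, h2, fun j h4 h5 h6 => by have := h3 j ⟨h4, h6⟩; omega⟩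

namespace Detour

variable {G : SimpleGraph V} {n m : ℤ} {c p : ℤ → V}

lemma locate_first (hd : Detour G n c m (m + 1) p) {t : ℤ} (h : G.Adj (p 1) (c t)) :
    (t ≤ 2 ∧ -2 ≤ t) ∨ n - 2 ≤ t ∨ t ≤ 2 - n := by
  have hm := hd.three_le
  have := hd.compat (i := 1) (j := 1) (by omega) le_rfl (by omega) (Or.inl rfl) hd.rung_first h
  omega

lemma locate_last (hd : Detour G n c m (m + 1) p) (hn : 2 * m + 1 ≤ n) {t : ℤ} (h0 : 0 ≤ t)
    (ht : t < n) (h : G.Adj (p (m - 1)) (c t)) : m - 1 ≤ t ∧ t ≤ m + 3 := by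
  have hm := hd.three_le
  have := hd.compat (i := m - 1) (j := m - 1) (by omega) le_rfl (by omega) (Or.inl rfl)
    hd.rung_last h
  omega

lemma locate_middle (hd : Detour G n c m (m + 1) p) (hn : 2 * m + 1 ≤ n) {i t : ℤ}
    (hi : 2 ≤ i) (hi' : i ≤ m - 2) (h0 : 0 ≤ t) (ht : t < n) (h : G.Adj (p i) (c t)) :
    t = i ∨ t = i + 1 ∨
      (m + 1 < t ∧ n ≤ 2 * m + 3 ∧ n - 2 * m - 2 + i ≤ n - t ∧ n - t ≤ i + 1) := by
  have h1 := hd.compat (i := 1) (j := i) (by omega) (by omega) (by omega) (by omega)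
    hd.rung_first h
  have h2 := hd.compat (i := i) (j := m - 1) (by omega) (by omega) (by omega) (by omega) h
    hd.rung_last
  omega

lemma false_of_first_triple (hJ : ¬ ContainsJewel G) (hd : Detour G n c m (m + 1) p)
    (hn : 2 * m + 1 ≤ n) (h1 : G.Adj (p 1) (c 1)) (h2 : G.Adj (p 1) (c (n - 1)))
    (h : ∀ l, 2 ≤ l → l < m → ∃ z, 0 ≤ z ∧ z ≤ n ∧ ∀ t, 1 ≤ t → t ≤ n →
      (t < n ∧ G.Adj (p l) (c t) ∨ t = n ∧ l = 2) →
        (z ≤ t ∧ t ≤ z + 3) ∨ (z ≤ t + n ∧ t + n ≤ z + 3) ∨ (z ≤ t - n ∧ t - n ≤ z + 3)) :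
    False := by
  have hm := hd.three_le
  have := hd.hole.reroute hJ (p := p) (m := m) (i := 1) (y := n - 1) (k := m + 1) (by omega)
    le_rfl (by omega) (hd.path.mono (by omega) le_rfl) hd.off
    (hd.bound _ (by omega) (by omega)) (by omega) (by omega) hd.last ?_ ?_
  · omega
  · intro j t j1 j2 t1 t2
    obtain rfl : j = 1 := by omega
    constructor
    · intro ht
      have := hd.locate_first ht
      have := hd.compat (i := 1) (j := 1) (by omega) le_rfl (by omega) (Or.inl rfl) h1 ht
      have := hd.compat (i := 1) (j := 1) (by omega) le_rfl (by omega) (Or.inl rfl) h2 ht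
      omega
    · rintro (⟨-, rfl⟩ | ⟨-, rfl⟩)
      · exact h2
      · convert h1 using 2
        omega
  · intro l l1 l2
    obtain ⟨z, z1, z2, hz⟩ := h l (by omega) l2
    refine ⟨z, by omega, by omega, fun t t1 t2 ht => hz t (by omega) (by omega) ?_⟩
    rcases ht with ⟨ht, ht'⟩ | ⟨ht, ht'⟩
    · exact Or.inl ⟨by omega, ht'⟩
    · exact Or.inr ⟨by omega, by omega⟩

lemma no_rung_succ (hJ : ¬ ContainsJewel G) (hd : Detour G n c m (m + 1) p)
    (hn : 2 * m + 1 ≤ n)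
    (hfar : ∀ i t, 0 < i → i < m → m + 1 < t → t < n → ¬ G.Adj (p i) (c t))
    {i : ℤ} (hi : 1 ≤ i) (him : i ≤ m - 2) : ¬ G.Adj (p i) (c (i + 1)) := by
  intro hR
  have hm := hd.three_le
  have hc := hd.hole.hole
  have hrung : ∀ j t, 1 ≤ j → j ≤ m - 1 → 0 ≤ t → t < n → G.Adj (p j) (c t) →
      t ≤ m + 1 ∧ (j - 1 ≤ t ∧ t ≤ j + 2) ∧ (j ≤ m - 2 → t ≤ j + 1) ∧ (2 ≤ j → j ≤ t) := by
    intro j t j1 j2 t1 t2 ht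
    have h1 : ¬ (m + 1 < t) := fun h => hfar j t (by omega) (by omega) h t2 ht
    by_cases e1 : j = 1
    · subst e1
      have := hd.locate_first ht
      omega
    · by_cases e2 : j = m - 1
      · subst e2
        have := hd.locate_last hn t1 t2 ht
        omega
      · have := hd.locate_middle hn (by omega) (by omega) t1 t2 ht
        omega
  have := hd.hole.reroute hJ (p := p) (m := m) (i := i) (y := n) (k := m + 1) (by omega)
    hi (by omega) (hd.path.mono (by omega) le_rfl) hd.off
    (hd.bound _ (by omega) (by omega)) (by omega) (by omega) hd.last ?_ ?_
  · omega
  · intro j t j1 j2 t1 t2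
    rcases t2.eq_or_lt with rfl | t2
    · rw [hc.periodic 0 t (by omega)]
      constructor
      · intro ht
        have := hrung j 0 j1 (by omega) le_rfl (by omega) ht
        omega
      · rintro (⟨rfl, -⟩ | ⟨rfl, h⟩)
        · exact hd.rung_first
        · omega
    · constructor
      · intro ht
        have := hrung j t j1 (by omega) (by omega) t2 ht
        omega
      · rintro (⟨rfl, h⟩ | ⟨rfl, rfl⟩)
        · omega
        · convert hR using 2
          omega
  · intro l l1 l2
    refine ⟨l - 1, by omega, by omega, ?_⟩
    rintro t t1 t2 (⟨t3, ht⟩ | ⟨rfl, rfl⟩)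
    · rcases t3.eq_or_lt with rfl | t3
      · rw [hc.periodic 0 t (by omega)] at ht
        have := hrung l 0 (by omega) (by omega) le_rfl (by omega) ht
        omega
      · have := hrung l t (by omega) (by omega) (by omega) t3 ht
        omega
    · omega

lemma far_reverse (hd : Detour G n c m (m + 1) p)
    (hfar : ∀ i t, 0 < i → i < m → m + 1 < t → t < n → ¬ G.Adj (p i) (c t)) :
    ∀ i t, 0 < i → i < m → m + 1 < t → t < n → ¬ G.Adj (p (m - i)) (c (m + 1 - t)) := by
  intro i t i1 i2 t1 t2
  rw [← hd.hole.hole.add_period]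
  exact hfar _ _ (by omega) (by omega) (by omega) (by omega)

/-- If both ends of a detour see the near arc next to the ends of the hole, a shorter odd hole
appears. -/
lemma false_of_near_ends (hd : Detour G n c m (m + 1) p) (hn : 2 * m + 1 ≤ n)
    (hmid : ∀ i t, 2 ≤ i → i ≤ m - 2 → 0 < t → t < m + 1 → ¬ G.Adj (p i) (c t))
    (h1 : G.Adj (p 1) (c 1)) (h2 : G.Adj (p (m - 1)) (c m)) (h1' : ¬ G.Adj (p 1) (c 2))
    (h2' : ¬ G.Adj (p (m - 1)) (c (m - 1))) : False := by
  have hm := hd.three_le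
  refine hd.hole.false_of_splice (q := fun t => p (2 * m - t)) (x := 1) (y := m)
    (l := 2 * m - 1) (by omega) (by omega) ⟨m - 1, by ring⟩ (by omega) (by omega) (by omega)
    (hd.path.reflect (2 * m) _ _ (by omega) (by omega))
    (fun s t _ _ _ _ => hd.off _ _ (by omega) (by omega)) ?_
  intro s t s1 s2 t1 t2
  constructor
  · intro ht
    by_cases e1 : s = m + 1
    · subst e1
      have ht' : G.Adj (p (m - 1)) (c t) := by convert ht using 2; omega
      have := hd.locate_last hn (by omega) (by omega) ht'
      have : t ≠ m - 1 := by rintro rfl; exact h2' ht'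
      omega
    · by_cases e2 : s = 2 * m - 1
      · subst e2
        have ht' : G.Adj (p 1) (c t) := by convert ht using 2; omega
        have := hd.locate_first ht'
        have : t ≠ 2 := by rintro rfl; exact h1' ht'
        omega
      · exact absurd ht (hmid _ _ (by omega) (by omega) (by omega) (by omega))
  · rintro (⟨rfl, rfl⟩ | ⟨rfl, rfl⟩)
    · convert h2 using 2
      omega
    · convert h1 using 2
      omega

lemma false_of_near_first (hP : ¬ ContainsPyramid G) (hd : Detour G n c m (m + 1) p)
    (hn : 2 * m + 1 ≤ n)
    (hfar : ∀ i t, 0 < i → i < m → m + 1 < t → t < n → ¬ G.Adj (p i) (c t))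
    (hmid : ∀ i t, 2 ≤ i → i ≤ m - 2 → 0 < t → t < m + 1 → ¬ G.Adj (p i) (c t))
    (h1 : G.Adj (p 1) (c 1)) (h1' : ¬ G.Adj (p 1) (c 2))
    (h2 : ∀ t, 0 < t → t < m + 1 → ¬ G.Adj (p (m - 1)) (c t)) : False := by
  have hm := hd.three_le
  refine hP (hd.hole.hole.containsPyramid (q := p) (s := m - 1) (z := m + 1) (by omega)
    (by omega) (by omega) (by omega) (hd.path.mono (by omega) (by omega))
    (fun i t _ _ _ _ => hd.off _ _ (by omega) (by omega)) ?_)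
  intro i t i1 i2 t1 t2
  constructor
  · intro ht
    have h3 : ¬ (m + 1 < t) := fun h => hfar i t (by omega) (by omega) h t2 ht
    by_cases e1 : i = 1
    · subst e1
      have := hd.locate_first ht
      have : t ≠ 2 := by rintro rfl; exact h1' ht
      omega
    · by_cases e2 : i = m - 1
      · subst e2
        have := hd.locate_last hn t1 t2 ht
        have : ¬ (0 < t ∧ t < m + 1) := fun h => h2 t h.1 h.2 ht
        omega
      · have := hd.locate_middle hn (by omega) (by omega) t1 t2 ht
        exact absurd ht (hmid _ _ (by omega) (by omega) (by omega) (by omega))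
  · rintro (⟨rfl, rfl | rfl⟩ | ⟨rfl, rfl⟩)
    · exact hd.rung_first
    · exact h1
    · exact hd.rung_last

lemma no_near_rung_of_no_far_rung (hJ : ¬ ContainsJewel G) (hP : ¬ ContainsPyramid G)
    (hd : Detour G n c m (m + 1) p) (hn : 2 * m + 1 ≤ n)
    (hfar : ∀ i t, 0 < i → i < m → m + 1 < t → t < n → ¬ G.Adj (p i) (c t)) :
    ∀ i t, 0 < i → i < m → 0 < t → t < m + 1 → ¬ G.Adj (p i) (c t) := by
  have hm := hd.three_le
  have hfar' := hd.far_reverse hfar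
  have hsucc : ∀ i, 1 ≤ i → i ≤ m - 2 → ¬ G.Adj (p i) (c (i + 1)) :=
    fun i h1 h2 => hd.no_rung_succ hJ hn hfar h1 h2
  have hself : ∀ i, 2 ≤ i → i ≤ m - 1 → ¬ G.Adj (p i) (c i) := by
    intro i h1 h2
    have := hd.reverse.no_rung_succ hJ hn hfar' (i := m - i) (by omega) (by omega)
    convert this using 3 <;> omega
  have hmid : ∀ i t, 2 ≤ i → i ≤ m - 2 → 0 < t → t < m + 1 → ¬ G.Adj (p i) (c t) := by
    intro i t h1 h2 h3 h4 ht
    obtain rfl | rfl : t = i ∨ t = i + 1 := by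
      have := hd.locate_middle hn h1 h2 (by omega) (by omega) ht
      omega
    · exact hself t h1 (by omega) ht
    · exact hsucc i (by omega) h2 ht
  have h12 : ¬ G.Adj (p 1) (c 2) := hsucc 1 le_rfl (by omega)
  have hlast := hself (m - 1) (by omega) le_rfl
  have h1 : ¬ G.Adj (p 1) (c 1) := by
    intro h1
    by_cases h2 : G.Adj (p (m - 1)) (c m)
    · exact hd.false_of_near_ends hn hmid h1 h2 h12 hlast
    · refine hd.false_of_near_first hP hn hfar hmid h1 h12 fun t h3 h4 ht => ?_
      obtain rfl | rfl : t = m - 1 ∨ t = m := by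
        have := hd.locate_last hn (by omega) (by omega) ht
        omega
      · exact hlast ht
      · exact h2 ht
  have h2 : ¬ G.Adj (p (m - 1)) (c m) := by
    intro h2
    refine hd.reverse.false_of_near_first hP hn hfar'
      (fun i t _ _ _ _ => hmid _ _ (by omega) (by omega) (by omega) (by omega)) ?_ ?_ ?_
    · convert h2 using 2
      omega
    · convert hlast using 3
      omega
    · intro t h3 h4 ht
      have ht' : G.Adj (p 1) (c (m + 1 - t)) := by convert ht using 2; omega
      obtain h | h : m + 1 - t = 1 ∨ m + 1 - t = 2 := by
        have := hd.locate_first ht'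
        omega
      · rw [h] at ht'; exact h1 ht'
      · rw [h] at ht'; exact h12 ht'
  intro i t i1 i2 t1 t2 ht
  by_cases e1 : i = 1
  · subst e1
    obtain rfl | rfl : t = 1 ∨ t = 2 := by
      have := hd.locate_first ht
      omega
    exacts [h1 ht, h12 ht]
  · by_cases e2 : i = m - 1
    · subst e2
      obtain rfl | rfl : t = m - 1 ∨ t = m := by
        have := hd.locate_last hn (by omega) (by omega) ht
        omega
      exacts [hlast ht, h2 ht]
    · exact hmid i t (by omega) (by omega) t1 t2 ht

end Detour

namespace Detour

variable {G : SimpleGraph V} {n m K : ℤ} {c p : ℤ → V}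

lemma compat_middle (hd : Detour G n c m K p) {i j x y : ℤ} (hi : 2 ≤ i) (hi' : i ≤ m - 2)
    (hj : 2 ≤ j) (hj' : j ≤ m - 2) (hx : G.Adj (p i) (c x)) (hy : G.Adj (p j) (c y)) :
    ∃ d, (d = j - i ∨ d = i - j) ∧ 0 ≤ d ∧
      ((y - x ≤ d + 2 ∧ x - y ≤ d + 2) ∨ n - (y - x) ≤ d + 2 ∨ n - (x - y) ≤ d + 2) := by
  rcases le_total i j with h | h
  · exact ⟨j - i, by omega, by omega,
      hd.compat (by omega) h (by omega) (by omega) hx hy⟩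
  · refine ⟨i - j, by omega, by omega, ?_⟩
    have := hd.compat (by omega) h (by omega) (by omega) hy hx
    omega

lemma false_of_near_middle_rung_self (hJ : ¬ ContainsJewel G) (hP : ¬ ContainsPyramid G)
    (hd : Detour G n c m (m + 1) p) (hn : 2 * m + 1 ≤ n) {i₀ : ℤ} (hi : 2 ≤ i₀)
    (hi' : i₀ ≤ m - 2) (hR : G.Adj (p i₀) (c i₀)) (h1 : G.Adj (p 1) (c (n - 1))) : False := by
  have hc := hd.hole.hole
  have hmid : ∀ i t, 2 ≤ i → i ≤ m - 2 → 0 ≤ t → t < n → G.Adj (p i) (c t) → t = i := by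
    intro i t i1 i2 t1 t2 ht
    have e1 := hd.locate_middle hn i1 i2 t1 t2 ht
    have e2 := hd.compat (by omega) (by omega) (by omega) (by omega) h1 ht
    obtain ⟨d, d1, d2, d3⟩ := hd.compat_middle hi hi' i1 i2 hR ht
    omega
  have hlast : ∀ t, 0 ≤ t → t < n → G.Adj (p (m - 1)) (c t) → m - 1 ≤ t ∧ t ≤ m + 1 := by
    intro t t1 t2 ht
    have e1 := hd.locate_last hn t1 t2 ht
    have e2 := hd.compat (by omega) (by omega) (by omega) (by omega) hR ht
    omega
  by_cases h11 : G.Adj (p 1) (c 1)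
  · refine hd.false_of_first_triple hJ hn h11 h1 fun l l1 l2 => ?_
    by_cases e : l = m - 1
    · subst e
      refine ⟨m - 1, by omega, by omega, ?_⟩
      rintro t t1 t2 (⟨t3, ht⟩ | ⟨-, h⟩)
      · have := hlast t (by omega) t3 ht
        omega
      · omega
    · refine ⟨l - 2, by omega, by omega, ?_⟩
      rintro t t1 t2 (⟨t3, ht⟩ | ⟨rfl, rfl⟩)
      · have := hmid l t l1 (by omega) (by omega) t3 ht
        omega
      · omega
  · obtain ⟨i, i1, i2, hi1, hfirst⟩ := exists_first (P := fun i => G.Adj (p i) (c i)) hi hR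
    refine hP ((hc.shift (-1)).containsPyramid (q := p) (s := i) (z := i + 1) (by omega)
      (by omega) (by omega) (by omega) (hd.path.mono (by omega) (by omega))
      (fun i t _ _ _ _ => hd.off _ _ (by omega) (by omega)) ?_)
    intro j t j1 j2 t1 t2
    rcases t1.eq_or_lt with rfl | t1
    · rw [← hc.periodic (0 + -1) (n - 1) (by omega)]
      constructor
      · intro ht
        by_cases e : j = 1
        · omega
        · have := hmid j _ (by omega) (by omega) (by omega) (by omega) ht
          omega
      · rintro (⟨rfl, -⟩ | ⟨rfl, h⟩)
        · exact h1
        · omega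
    · constructor
      · intro ht
        by_cases e : j = 1
        · subst e
          have h2 := hd.locate_first ht
          have h3 := hd.compat (by omega) le_rfl (by omega) (Or.inl rfl) h1 ht
          have h5 := hd.compat (by omega) (by omega) (by omega) (by omega) ht hR
          have h4 : t + -1 ≠ 1 := by
            intro h
            rw [h] at ht
            exact h11 ht
          omega
        · have := hmid j _ (by omega) (by omega) (by omega) (by omega) ht
          have : ¬ (j < i) := by
            intro h
            apply hfirst j (by omega) h
            rwa [this] at ht
          omega
      · rintro (⟨rfl, rfl | rfl⟩ | ⟨rfl, rfl⟩)
        · omega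
        · simpa using hd.rung_first
        · convert hi1 using 2
          omega

lemma false_of_near_middle_rung (hJ : ¬ ContainsJewel G) (hP : ¬ ContainsPyramid G)
    (hd : Detour G n c m (m + 1) p) (hn : 2 * m + 1 ≤ n) {i₀ t₀ j y : ℤ} (hi : 2 ≤ i₀)
    (hi' : i₀ ≤ m - 2) (ht₀ : 0 < t₀) (ht₀' : t₀ < m + 1) (hR : G.Adj (p i₀) (c t₀))
    (hj : 0 < j) (hj' : j < m) (hy : m + 1 < y) (hy' : y < n) (h : G.Adj (p j) (c y)) :
    False := by
  have e0 := hd.locate_middle hn hi hi' (by omega) (by omega) hR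
  by_cases e1 : j = 1
  · subst e1
    have e2 := hd.locate_first h
    have e3 := hd.compat (by omega) (by omega) (by omega) (by omega) h hR
    obtain rfl : y = n - 1 := by omega
    obtain rfl : t₀ = i₀ := by omega
    exact hd.false_of_near_middle_rung_self hJ hP hn hi hi' hR h
  · by_cases e2 : j = m - 1
    · subst e2
      have e2 := hd.locate_last hn (by omega) hy' h
      have e3 := hd.compat (by omega) (by omega) (by omega) (by omega) hR h
      refine hd.reverse.false_of_near_middle_rung_self hJ hP hn (i₀ := m - i₀) (by omega)
        (by omega) ?_ ?_
      · convert hR using 2 <;> omega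
      · rw [← hd.hole.hole.add_period]
        convert h using 2
        omega
    · have e3 := hd.locate_middle hn (by omega) (by omega) (by omega) hy' h
      obtain ⟨d, d1, d2, d3⟩ := hd.compat_middle hi hi' (by omega) (by omega) hR h
      omega

lemma false_of_far_middle_rung (hJ : ¬ ContainsJewel G) (hP : ¬ ContainsPyramid G)
    (hd : Detour G n c m (m + 1) p) (hn : 2 * m + 1 ≤ n)
    (hmid : ∀ i t, 2 ≤ i → i ≤ m - 2 → 0 < t → t < m + 1 → ¬ G.Adj (p i) (c t))
    {j₀ y₀ t₁ : ℤ} (hj : 2 ≤ j₀) (hj' : j₀ ≤ m - 2) (hy : m + 1 < y₀) (hy' : y₀ < n)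
    (hR : G.Adj (p j₀) (c y₀)) (ht₁ : 0 < t₁) (ht₁' : t₁ < m + 1) (h : G.Adj (p 1) (c t₁)) :
    False := by
  have hc := hd.hole.hole
  have hodd := hd.hole.odd
  rw [Int.odd_iff] at hodd
  have e0 := hd.locate_middle hn hj hj' (by omega) hy' hR
  have e1 := hd.locate_first h
  have e2 := hd.compat (by omega) (by omega) (by omega) (by omega) h hR
  have hn' : n = 2 * m + 1 := by omega
  have h12 : ¬ G.Adj (p 1) (c 2) := by
    intro h12
    have e3 := hd.compat (by omega) (by omega) (by omega) (by omega) h12 hR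
    refine hd.hole.false_of_splice (q := fun t => p (2 * m + 1 - t)) (x := 2) (y := m + 1)
      (l := 2 * m - 1) (by omega) (by omega) ⟨m - 1, by ring⟩ (by omega) (by omega) (by omega)
      (hd.path.reflect (2 * m + 1) _ _ (by omega) (by omega))
      (fun s t _ _ _ _ => hd.off _ _ (by omega) (by omega)) ?_
    intro s t s1 s2 t1 t2
    constructor
    · intro ht
      by_cases e4 : s = m + 2
      · have ht' : G.Adj (p (m - 1)) (c t) := by convert ht using 2; omega
        have e5 := hd.locate_last hn (by omega) (by omega) ht'
        have e6 := hd.compat (by omega) (by omega) (by omega) (by omega) hR ht'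
        omega
      · by_cases e5 : s = 2 * m
        · have ht' : G.Adj (p 1) (c t) := by convert ht using 2; omega
          have := hd.locate_first ht'
          omega
        · have := hd.locate_middle hn (by omega) (by omega) (by omega) (by omega) ht
          exact absurd ht (hmid _ _ (by omega) (by omega) (by omega) (by omega))
    · rintro (⟨rfl, rfl⟩ | ⟨rfl, rfl⟩)
      · convert hd.rung_last using 2
        omega
      · convert h12 using 2
        omega
  have h11 : G.Adj (p 1) (c 1) := by
    have : t₁ ≠ 2 := by rintro rfl; exact h12 h
    rwa [show t₁ = 1 by omega] at h
  have hlast : ∀ t, 0 ≤ t → t < n → G.Adj (p (m - 1)) (c t) → m + 1 ≤ t ∧ t ≤ m + 3 := by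
    intro t t1 t2 ht
    have e3 := hd.locate_last hn t1 t2 ht
    have hl : ¬ G.Adj (p (m - 1)) (c (m - 1)) := by
      intro hl
      have := hd.compat (by omega) (by omega) (by omega) (by omega) hR hl
      omega
    have e4 : t ≠ m - 1 := by rintro rfl; exact hl ht
    have e5 : t ≠ m := by rintro rfl; exact hd.false_of_near_ends hn hmid h11 ht h12 hl
    omega
  have hmid' : ∀ i t, 2 ≤ i → i ≤ m - 2 → 0 ≤ t → t < n → G.Adj (p i) (c t) →
      t = n - i ∨ t = n - i + 1 := by
    intro i t i1 i2 t1 t2 ht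
    have e3 := hd.locate_middle hn i1 i2 t1 t2 ht
    have e4 := hd.compat (by omega) (by omega) (by omega) (by omega) h11 ht
    have e5 : ¬ (0 < t ∧ t < m + 1) := fun h => hmid i t i1 i2 h.1 h.2 ht
    omega
  have h1n : ¬ G.Adj (p 1) (c (n - 1)) := by
    intro h1n
    refine hd.false_of_first_triple hJ hn h11 h1n fun l l1 l2 => ?_
    by_cases e : l = m - 1
    · subst e
      refine ⟨m + 1, by omega, by omega, ?_⟩
      rintro t t1 t2 (⟨t3, ht⟩ | ⟨-, h⟩)
      · have := hlast t (by omega) t3 ht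
        omega
      · omega
    · refine ⟨n - l - 1, by omega, by omega, ?_⟩
      rintro t t1 t2 (⟨t3, ht⟩ | ⟨rfl, rfl⟩)
      · have := hmid' l t l1 (by omega) (by omega) t3 ht
        omega
      · omega
  have hfirst : ∀ t, 0 ≤ t → t < n → (G.Adj (p 1) (c t) ↔ t = 0 ∨ t = 1) := by
    intro t t1 t2
    constructor
    · intro ht
      have e3 := hd.locate_first ht
      have e4 := hd.compat (by omega) le_rfl (by omega) (Or.inl rfl) h11 ht
      have e5 : t ≠ 2 := by rintro rfl; exact h12 ht
      have e6 : t ≠ n - 1 := by rintro rfl; exact h1n ht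
      omega
    · rintro (rfl | rfl)
      exacts [hd.rung_first, h11]
  obtain ⟨j, j1, j2, ⟨u, u1, u2, hu⟩, hleast⟩ := exists_first
    (P := fun j => ∃ u, 0 ≤ u ∧ u < n ∧ G.Adj (p j) (c u)) hj ⟨y₀, by omega, hy', hR⟩
  have hnone : ∀ i t, 2 ≤ i → i < j → 0 ≤ t → t < n → ¬ G.Adj (p i) (c t) :=
    fun i t i1 i2 t1 t2 ht => hleast i i1 i2 ⟨t, t1, t2, ht⟩
  have hu' := hmid' j u j1 (by omega) u1 u2 hu
  by_cases hboth : G.Adj (p j) (c (n - j)) ∧ G.Adj (p j) (c (n - j + 1))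
  · have := (hd.hole.reflect n).reroute hJ (p := p) (m := m) (i := j) (y := n - 1)
      (k := n - (m + 1)) (by omega) (by omega) (by omega) (hd.path.mono (by omega) le_rfl)
      (fun j t j1 j2 => hd.off _ _ j1 j2) (hd.bound _ (by omega) (by omega)) (by omega)
      (by omega) (by rw [hd.last]; congr 1; omega) ?_ ?_
    · omega
    · intro i t i1 i2 t1 t2
      by_cases e3 : i = 1
      · subst e3
        rw [hfirst _ (by omega) (by omega)]
        omega
      · by_cases e4 : i = j
        · subst e4
          constructor
          · intro ht
            have := hmid' _ _ j1 (by omega) (by omega) (by omega) ht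
            omega
          · rintro (⟨h, -⟩ | ⟨-, rfl⟩)
            · omega
            · convert hboth.1 using 2
              omega
        · have := hnone i (n - t) (by omega) (by omega) (by omega) (by omega)
          simp only [this, false_iff]
          omega
    · intro l l1 l2
      refine ⟨l - 2, by omega, by omega, ?_⟩
      rintro t t1 t2 (⟨t3, ht⟩ | ⟨rfl, rfl⟩)
      · by_cases e : l = m - 1
        · subst e
          have := hlast _ (by omega) (by omega) ht
          omega
        · have := hmid' l _ (by omega) (by omega) (by omega) (by omega) ht
          omega
      · omega
  · refine hP (hc.containsPyramid (q := p) (s := j) (z := u) (by omega)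
      (by omega) (by omega) (by omega) (hd.path.mono (by omega) (by omega))
      (fun i t _ _ _ _ => hd.off _ _ (by omega) (by omega)) ?_)
    intro i t i1 i2 t1 t2
    by_cases e3 : i = 1
    · subst e3
      rw [hfirst t t1 t2]
      omega
    · by_cases e4 : i = j
      · subst e4
        constructor
        · intro ht
          have ht' := hmid' _ _ j1 (by omega) t1 t2 ht
          by_contra hne
          apply hboth
          rcases hu' with rfl | rfl <;> rcases ht' with rfl | rfl
          · omega
          · exact ⟨hu, ht⟩
          · exact ⟨ht, hu⟩
          · omega
        · rintro (⟨h, -⟩ | ⟨-, rfl⟩)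
          · omega
          · exact hu
      · have := hnone i t (by omega) (by omega) t1 t2
        simp only [this, false_iff]
        omega

lemma false_of_tight_ends (hJ : ¬ ContainsJewel G) {n : ℤ} (hd : Detour G n c m (m + 1) p)
    (hm : m = 3) (hn : n = 7) (hA : Span G n c (p 1) 0 1 1)
    (hB : Span G n c (p (m - 1)) (m + 1) 2 0) : False := by
  have hc := hd.hole.hole
  refine hd.false_of_first_triple hJ (by omega) (by simpa using hA.adj) ?_ fun l l1 l2 =>
    ⟨4, by omega, by omega, ?_⟩
  · rw [hc.periodic (0 - 1) (n - 1) (by omega)]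
    exact hA.adj'
  · rintro t t1 t2 (⟨t3, ht⟩ | ⟨rfl, rfl⟩)
    · obtain rfl : l = m - 1 := by omega
      by_contra
      have := hB.eq (t + n) (by omega) (by omega) (by rwa [hc.add_period])
      omega
    · omega

/-- A detour of length `m` joining two vertices of the hole at distance `m + 1` along an arc
has no neighbours in the interior of that arc. -/
theorem no_near_rung (hJ : ¬ ContainsJewel G) (hP : ¬ ContainsPyramid G)
    (hd : Detour G n c m (m + 1) p) (hn : 2 * m + 1 ≤ n) :
    ∀ i t, 0 < i → i < m → 0 < t → t < m + 1 → ¬ G.Adj (p i) (c t) := by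
  have hm := hd.three_le
  have hc := hd.hole.hole
  by_cases hfar : ∀ i t, 0 < i → i < m → m + 1 < t → t < n → ¬ G.Adj (p i) (c t)
  · exact hd.no_near_rung_of_no_far_rung hJ hP hn hfar
  push Not at hfar
  obtain ⟨j, y, j1, j2, y1, y2, hy⟩ := hfar
  have hmid : ∀ i t, 2 ≤ i → i ≤ m - 2 → 0 < t → t < m + 1 → ¬ G.Adj (p i) (c t) :=
    fun i t i1 i2 t1 t2 ht =>
      hd.false_of_near_middle_rung hJ hP hn i1 i2 t1 t2 ht j1 j2 y1 y2 hy
  intro i t i1 i2 t1 t2 ht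
  have hi : i = 1 ∨ i = m - 1 := by
    by_contra
    exact hmid i t (by omega) (by omega) t1 t2 ht
  have hfarmid : ∀ l s, 2 ≤ l → l ≤ m - 2 → m + 1 < s → s < n → ¬ G.Adj (p l) (c s) := by
    intro l s l1 l2 s1 s2 hs
    rcases hi with rfl | rfl
    · exact hd.false_of_far_middle_rung hJ hP hn hmid l1 l2 s1 s2 hs t1 t2 ht
    · refine hd.reverse.false_of_far_middle_rung hJ hP hn
        (fun i t _ _ _ _ => hmid _ _ (by omega) (by omega) (by omega) (by omega))
        (j₀ := m - l) (y₀ := m + 1 - s + n) (t₁ := m + 1 - t) (by omega) (by omega) (by omega)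
        (by omega) ?_ (by omega) (by omega) ?_
      · rw [← hc.add_period]
        convert hs using 2 <;> omega
      · convert ht using 2
        omega
  have hnone : ∀ l s, 2 ≤ l → l ≤ m - 2 → ¬ G.Adj (p l) (c s) := by
    intro l s l1 l2 hs
    obtain ⟨e, he, e1, e2⟩ := hc.exists_period 0 s
    rw [← he s] at hs
    have h1 := hd.locate_middle hn l1 l2 e1 (by omega) hs
    have h2 : ¬ (0 < s + e ∧ s + e < m + 1) := fun h => hmid l _ l1 l2 h.1 h.2 hs
    exact hfarmid l _ l1 l2 (by omega) (by omega) hs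
  have hj : j = 1 ∨ j = m - 1 := by
    by_contra
    exact hnone j y (by omega) (by omega) hy
  obtain ⟨α, ν, hA⟩ := (hd.minor 1 (by omega) (by omega)).exists_span hc (by omega) hd.rung_first
  obtain ⟨ν', α', hB⟩ :=
    (hd.minor (m - 1) (by omega) (by omega)).exists_span hc (by omega) hd.rung_last
  have a1 := hA.nonneg
  have a2 := hA.nonneg'
  have a3 := hA.add_le
  have b1 := hB.nonneg
  have b2 := hB.nonneg'
  have b3 := hB.add_le
  have hα : 1 ≤ α + α' := by
    rcases hi with rfl | rfl
    · have e1 := hd.locate_first ht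
      by_contra
      have := hA.eq t (by omega) (by omega) ht
      omega
    · have e1 := hd.locate_last hn (by omega) (by omega) ht
      by_contra
      have := hB.eq (t + n) (by omega) (by omega) (by rwa [hc.add_period])
      omega
  have hν : 1 ≤ ν + ν' := by
    rcases hj with rfl | rfl
    · have e1 := hd.locate_first hy
      by_contra
      have := hA.eq y (by omega) (by omega) hy
      omega
    · have e1 := hd.locate_last hn (by omega) (by omega) hy
      by_contra
      have := hB.eq y (by omega) (by omega) hy
      omega
  by_cases hd2 : 1 ≤ n - (m + 1) - ν - ν'
  · exact hd.false_of_no_middle_rung hP hnone hA hB (by omega) hd2 (by omega) (by omega)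
  · rcases (show ν = 1 ∨ ν = 2 by omega) with rfl | rfl
    · obtain rfl : ν' = 2 := by omega
      obtain rfl : α' = 0 := by omega
      obtain rfl : α = 1 := by omega
      exact hd.false_of_tight_ends hJ (by omega) (by omega) hA hB
    · obtain rfl : ν' = 1 := by omega
      obtain rfl : α' = 1 := by omega
      obtain rfl : α = 0 := by omega
      refine hd.reverse.false_of_tight_ends hJ (by omega) (by omega)
        (hB.reflect hc _ _ (by omega)) ?_
      have := hA.reflect hc (m + 1) (m + 1) (by omega)
      simpa using this

end Detour

/-- A walk that is no longer than either arc between its ends is induced. -/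
lemma ShortestOddCyclicHole.inducedOn_of_bound {G : SimpleGraph V} {n m K : ℤ} {c p : ℤ → V}
    (hc : ShortestOddCyclicHole G n c) (hbound : ∀ l, 0 ≤ l → l < m → ArcBound G l)
    (hwalk : ∀ i, 0 ≤ i → i < m → G.Adj (p i) (p (i + 1))) (hfirst : p 0 = c 0)
    (hlast : p m = c K) (hminor : ∀ i, 0 < i → i < m → IsMinor G n c (p i))
    (hK : m ≤ K) (hK' : m ≤ n - K) : InducedOn G p 0 m := by
  have cut : ∀ s d, 0 ≤ s → 0 < d → s + d ≤ m → (s + d = m → p s = p m) →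
      (s + d < m → G.Adj (p s) (p (s + d + 1))) → False := by
    intro s d s1 d1 d2 hend hstep
    obtain ⟨w, hw1, hw2⟩ : ∃ w : ℤ → V, (∀ i, i ≤ s → w i = p i) ∧
        ∀ i, s < i → w i = p (i + d) :=
      ⟨fun i => if i ≤ s then p i else p (i + d), fun i hi => if_pos hi,
        fun i hi => if_neg (by omega)⟩
    have := hbound (m - d) (by omega) (by omega) n c hc w 0 (m - d) 0 K (by omega) ?_ ?_ ?_ ?_
    · omega
    · intro i i1 i2
      rcases lt_trichotomy i s with h | rfl | h
      · rw [hw1 i (by omega), hw1 (i + 1) (by omega)]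
        exact hwalk i i1 (by omega)
      · rw [hw1 i le_rfl, hw2 (i + 1) (by omega), add_right_comm]
        exact hstep (by omega)
      · rw [hw2 i h, hw2 (i + 1) (by omega), add_right_comm]
        exact hwalk (i + d) (by omega) (by omega)
    · rw [hw1 0 s1, hfirst]
    · rcases d2.eq_or_lt with h | h
      · rw [hw1 _ (by omega), ← hlast, ← hend h]
        congr 1
        omega
      · rw [hw2 _ (by omega), sub_add_cancel, hlast]
    · intro i i1 i2
      rcases le_or_gt i s with h | h
      · rw [hw1 i h]
        exact hminor i i1 (by omega)
      · rw [hw2 i h]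
        exact hminor _ (by omega) (by omega)
  intro s t s1 st t2
  constructor
  · intro h
    refine cut s (t - s) s1 (by omega) (by omega) (fun e => ?_) (fun e => ?_)
    · rw [h]
      congr 1
      omega
    · rw [h, show s + (t - s) + 1 = t + 1 by omega]
      exact hwalk t (by omega) (by omega)
  · constructor
    · intro h
      by_contra hne
      refine cut s (t - s - 1) s1 (by omega) (by omega) (fun e => by omega) (fun e => ?_)
      rwa [show s + (t - s - 1) + 1 = t by omega]
    · rintro rfl
      exact hwalk s s1 (by omega)

namespace Detour

variable {G : SimpleGraph V} {n m K : ℤ} {c p : ℤ → V}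

lemma false_of_eq_add_one (hJ : ¬ ContainsJewel G) (hP : ¬ ContainsPyramid G)
    (hd : Detour G n c m (m + 1) p) (hn : 2 * m + 1 < n) : False := by
  have hm := hd.three_le
  refine hd.hole.false_of_splice (q := fun t => p (2 * m + 1 - t)) (x := 0) (y := m + 1)
    (l := 2 * m + 1) (by omega) (by omega) ⟨m, rfl⟩ (by omega) (by omega) (by omega)
    (hd.path.reflect (2 * m + 1) _ _ (by omega) (by omega))
    (fun s t _ _ _ _ => hd.off _ _ (by omega) (by omega)) ?_
  intro s t s1 s2 t1 t2
  by_cases e1 : t = 0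
  · subst e1
    rw [← hd.first, hd.path.adj_iff (by omega) (by omega) (by omega) (by omega)]
    omega
  · by_cases e2 : t = m + 1
    · subst e2
      rw [← hd.last, hd.path.adj_iff (by omega) (by omega) (by omega) (by omega)]
      omega
    · have := hd.no_near_rung hJ hP (by omega) (2 * m + 1 - s) t (by omega) (by omega) (by omega)
        (by omega)
      simp only [this, false_iff]
      omega

lemma false_of_middle_rung (hd : Detour G n c m K p) (hK : m + 2 ≤ K) (hn : 2 * K < n)
    {i t : ℤ} (hi : 2 ≤ i) (hi' : i ≤ m - 2) (h : G.Adj (p i) (c t)) : False := by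
  have hm := hd.three_le
  have hc := hd.hole.hole
  have locate : ∀ j s, 2 ≤ j → j ≤ m - 2 → 0 ≤ s → s < n → G.Adj (p j) (c s) →
      s = j + 1 ∧ K = m + 2 := by
    intro j s j1 j2 s1 s2 hs
    have h1 := hd.compat (by omega) (by omega) (by omega) (by omega) hd.rung_first hs
    have h2 := hd.compat (by omega) (by omega) (by omega) (by omega) hs hd.rung_last
    omega
  obtain ⟨e, he, e1, e2⟩ := hc.exists_period 0 t
  rw [← he t] at h
  obtain ⟨ht, rfl⟩ := locate i _ hi hi' e1 (by omega) h
  rw [ht] at h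
  have hodd := hd.hole.odd
  rw [Int.odd_iff] at hodd
  refine hd.hole.false_of_splice (q := fun s => p (s + -n)) (x := m + 2) (y := n)
    (l := n - 2) (by omega) (by omega) (by rw [Int.odd_iff]; omega) (by omega) (by omega)
    (by omega) (hd.path.shift (-n) _ _ (by omega) (by omega))
    (fun s t _ _ _ _ => hd.off _ _ (by omega) (by omega)) ?_
  intro s r s1 s2 r1 r2
  rcases r2.eq_or_lt with rfl | r2
  · rw [hc.periodic 0 r (by omega), ← hd.first,
      hd.path.adj_iff (by omega) (by omega) (by omega) (by omega)]
    omega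
  · constructor
    · intro hr
      by_cases e3 : s = n + 1
      · have hr' : G.Adj (p 1) (c r) := by convert hr using 2; omega
        have h1 := hd.compat (by omega) le_rfl (by omega) (Or.inl rfl) hd.rung_first hr'
        have h2 := hd.compat (by omega) (by omega) (by omega) (by omega) hr' h
        omega
      · by_cases e4 : s = m + n - 1
        · have hr' : G.Adj (p (m - 1)) (c r) := by convert hr using 2; omega
          have h1 := hd.compat (by omega) le_rfl (by omega) (Or.inl rfl) hd.rung_last hr'
          have h2 := hd.compat (by omega) (by omega) (by omega) (by omega) h hr'
          omega
        · have := locate _ _ (by omega) (by omega) (by omega) r2 hr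
          omega
    · rintro (⟨-, h⟩ | ⟨rfl, rfl⟩)
      · omega
      · convert hd.rung_last using 2
        omega

lemma false_of_long (hJ : ¬ ContainsJewel G) (hP : ¬ ContainsPyramid G)
    (hd : Detour G n c m K p) (hK : m < K) (hn : 2 * K < n) : False := by
  have hm := hd.three_le
  have hc := hd.hole.hole
  rcases (show m + 1 ≤ K by omega).eq_or_lt with rfl | hK
  · exact hd.false_of_eq_add_one hJ hP (by omega)
  · obtain ⟨α, ν, hA⟩ :=
      (hd.minor 1 (by omega) (by omega)).exists_span hc (by omega) hd.rung_first
    obtain ⟨ν', α', hB⟩ :=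
      (hd.minor (m - 1) (by omega) (by omega)).exists_span hc (by omega) hd.rung_last
    have a1 := hA.nonneg
    have a2 := hA.nonneg'
    have a3 := hA.add_le
    have b1 := hB.nonneg
    have b2 := hB.nonneg'
    have b3 := hB.add_le
    exact hd.false_of_no_middle_rung hP
      (fun i t i1 i2 h => hd.false_of_middle_rung (by omega) hn i1 i2 h) hA hB (by omega)
      (by omega) (by omega) (by omega)

end Detour

lemma ShortestOddCyclicHole.false_of_short_walk {G : SimpleGraph V} {n m K : ℤ} {c p : ℤ → V}
    (hJ : ¬ ContainsJewel G) (hP : ¬ ContainsPyramid G)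
    (hc : ShortestOddCyclicHole G n c) (hm : 0 ≤ m)
    (hbound : ∀ l, 0 ≤ l → l < m → ArcBound G l)
    (hwalk : ∀ i, 0 ≤ i → i < m → G.Adj (p i) (p (i + 1))) (hfirst : p 0 = c 0)
    (hlast : p m = c K) (hminor : ∀ i, 0 < i → i < m → IsMinor G n c (p i))
    (hK : m < K) (hK' : 2 * K < n) : False := by
  rcases (show m = 0 ∨ m = 1 ∨ m = 2 ∨ 3 ≤ m by omega) with rfl | rfl | rfl | hm
  · exact hc.hole.ne 0 K (by omega) (by omega) (hfirst.symm.trans hlast)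
  · have h := hwalk 0 le_rfl (by omega)
    rw [hfirst, zero_add, hlast, hc.hole.adj_iff _ _ (by omega) (by omega)] at h
    omega
  · have h0 := hwalk 0 le_rfl (by omega)
    have h1 := hwalk 1 (by omega) (by omega)
    rw [hfirst] at h0
    rw [one_add_one_eq_two, hlast] at h1
    have := (hminor 1 (by omega) (by omega)).close hc.hole h0.symm h1
    omega
  · refine Detour.false_of_long hJ hP (p := p) ⟨hc, hm, hc.inducedOn_of_bound hbound hwalk hfirst
      hlast hminor (by omega) (by omega), hfirst, hlast, by omega, by omega, ?_, hminor, hbound⟩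
      hK hK'
    intro i t i1 i2 h
    obtain ⟨e, he, e1, e2⟩ := hc.hole.exists_period 0 t
    rw [← he t] at h
    have h1 := hbound i (by omega) i2 n c hc p 0 i 0 (t + e) (by omega)
      (fun j j1 j2 => hwalk j j1 (by omega)) hfirst h
      (fun j j1 j2 => hminor j (by omega) (by omega))
    have h2 := hbound (m - i) (by omega) (by omega) n c hc p i m (t + e) K (by omega)
      (fun j j1 j2 => hwalk j (by omega) (by omega)) h hlast
      (fun j j1 j2 => hminor j (by omega) (by omega))
    omega

lemma arcBound_of_lt {G : SimpleGraph V} (hJ : ¬ ContainsJewel G) (hP : ¬ ContainsPyramid G)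
    {m : ℤ} (hm : 0 ≤ m) (hbound : ∀ l, 0 ≤ l → l < m → ArcBound G l) : ArcBound G m := by
  intro n c hc p a b x y hb hwalk hx hy hminor
  subst hb
  have key : ∀ (c' : ℤ → V) (K : ℤ), ShortestOddCyclicHole G n c' → c' 0 = c x → c' K = c y →
      (∀ w, IsMinor G n c w → IsMinor G n c' w) → m < K → 2 * K < n → False := by
    intro c' K hc' h0 hK hw
    refine hc'.false_of_short_walk hJ hP (p := fun i => p (i + a)) hm hbound ?_ ?_ ?_ ?_
    · intro i i1 i2
      rw [add_right_comm]
      exact hwalk _ (by omega) (by omega)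
    · rw [zero_add, h0, hx]
    · rw [add_comm, hK, hy]
    · exact fun i i1 i2 => hw _ (hminor _ (by omega) (by omega))
  have up := fun K => key (fun t => c (t + x)) K (hc.shift x) (by simp)
  have down := fun K => key (fun t => c (x - t)) K (hc.reflect x) (by simp)
  have hodd := hc.odd
  rw [Int.odd_iff] at hodd
  by_contra hcon
  rcases le_total x y with hxy | hxy
  · by_cases h : 2 * (y - x) < n
    · exact up (y - x) (by simp) (fun w hw => hw.shift x) (by omega) h
    · refine down (n - (y - x)) ?_ (fun w hw => hw.reflect hc.hole x) (by omega) (by omega)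
      exact (hc.hole.periodic _ _ (by omega)).symm
  · by_cases h : 2 * (x - y) < n
    · exact down (x - y) (by simp) (fun w hw => hw.reflect hc.hole x) (by omega) h
    · refine up (n - (x - y)) ?_ (fun w hw => hw.shift x) (by omega) (by omega)
      exact hc.hole.periodic _ _ (by omega)

theorem arcBound {G : SimpleGraph V} (hJ : ¬ ContainsJewel G) (hP : ¬ ContainsPyramid G)
    {m : ℤ} (hm : 0 ≤ m) : ArcBound G m := by
  lift m to ℕ using hm
  induction m using Nat.strong_induction_on with
  | _ m ih =>
    refine arcBound_of_lt hJ hP (by omega) fun l l1 l2 => ?_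
    lift l to ℕ using l1
    exact ih l (by omega)

/-- In a clean shortest odd hole, the interior of a path joining `c 0` and `c k` that is as
short as the arc between them neither meets nor sees the interior of the other arc. -/
theorem ShortestOddCyclicHole.far_from_geodesic {G : SimpleGraph V} (hJ : ¬ ContainsJewel G)
    (hP : ¬ ContainsPyramid G) {n : ℤ} (k : ℕ) : ∀ {c p : ℤ → V},
    ShortestOddCyclicHole G n c → (∀ w, IsMinor G n c w) → 2 * (k : ℤ) < n →
    (∀ i : ℤ, 0 ≤ i → i < k → G.Adj (p i) (p (i + 1))) → p 0 = c 0 → p k = c k →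
    ∀ i x : ℤ, 0 < i → i < k → (k : ℤ) < x → x < n → p i ≠ c x ∧ ¬ G.Adj (p i) (c x) := by
  induction k using Nat.strong_induction_on with
  | _ k ih =>
  intro c p hc hclean hk hwalk hfirst hlast
  have hodd := hc.odd
  rw [Int.odd_iff] at hodd
  by_cases hoff : ∀ i t : ℤ, 0 < i → i < k → p i ≠ c t
  swap
  · push Not at hoff
    obtain ⟨i, t, i1, i2, h⟩ := hoff
    obtain ⟨e, he, e1, e2⟩ := hc.hole.exists_period 0 t
    rw [← he t] at h
    have h1 := arcBound hJ hP (m := i) (by omega) n c hc p 0 i 0 (t + e) (by omega)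
      (fun j j1 j2 => hwalk j j1 (by omega)) hfirst h (fun j _ _ => hclean _)
    have h2 := arcBound hJ hP (m := k - i) (by omega) n c hc p i k (t + e) k (by omega)
      (fun j j1 j2 => hwalk j (by omega) (by omega)) h hlast (fun j _ _ => hclean _)
    rw [show t + e = i by omega] at h
    intro j x j1 j2 x1 x2
    lift i to ℕ using by omega
    rcases lt_trichotomy j i with hj | rfl | hj
    · exact ih i (by omega) hc hclean (by omega) (fun s s1 s2 => hwalk s s1 (by omega)) hfirst h
        j x j1 hj (by omega) x2
    · rw [h, hc.hole.adj_iff _ _ (by omega) (by omega)]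
      exact ⟨hc.hole.ne _ _ (by omega) (by omega), by omega⟩
    · have := ih (k - i) (by omega) (hc.shift i) (p := fun s => p (s + i))
        (fun w => (hclean w).shift i) (by omega) (fun s s1 s2 => ?_) (by simpa using h) ?_
        (j - i) (x - i) (by omega) (by omega) (by omega) (by omega)
      · simpa using this
      · rw [add_right_comm]
        exact hwalk _ (by omega) (by omega)
      · rw [show ((k - i : ℕ) : ℤ) + i = k by omega]
        exact hlast
  intro i x i1 i2 x1 x2
  refine ⟨hoff i x i1 i2, fun hx => ?_⟩
  have h1 : (x - 0 ≤ i + 1 ∧ 0 - x ≤ i + 1) ∨ n - (x - 0) ≤ i + 1 ∨ n - (0 - x) ≤ i + 1 := by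
    obtain ⟨w, hw1, hw2⟩ : ∃ w : ℤ → V, (∀ j, j ≤ i → w j = p j) ∧ w (i + 1) = c x :=
      ⟨fun j => if j ≤ i then p j else c x, fun j hj => if_pos hj, if_neg (by omega)⟩
    refine arcBound hJ hP (m := i + 1) (by omega) n c hc w 0 (i + 1) 0 x (by omega) ?_
      (by rw [hw1 0 (by omega), hfirst]) hw2 (fun j _ _ => hclean _)
    intro j j1 j2
    rcases (show j ≤ i by omega).eq_or_lt with rfl | h
    · rwa [hw1 j le_rfl, hw2]
    · rw [hw1 j h.le, hw1 (j + 1) (by omega)]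
      exact hwalk j j1 (by omega)
  have h2 : (k - x ≤ k - i + 1 ∧ x - k ≤ k - i + 1) ∨ n - (k - x) ≤ k - i + 1 ∨
      n - (x - k) ≤ k - i + 1 := by
    obtain ⟨w, hw1, hw2⟩ : ∃ w : ℤ → V, (∀ j, i ≤ j → w j = p j) ∧ w (i - 1) = c x :=
      ⟨fun j => if i ≤ j then p j else c x, fun j hj => if_pos hj, if_neg (by omega)⟩
    refine arcBound hJ hP (m := k - i + 1) (by omega) n c hc w (i - 1) k x k (by omega) ?_ hw2
      (by rw [hw1 k (by omega), hlast]) (fun j _ _ => hclean _)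
    intro j j1 j2
    rcases j1.eq_or_lt with rfl | h
    · rw [hw2, hw1 _ (by omega), sub_add_cancel]
      exact hx.symm
    · rw [hw1 j (by omega), hw1 (j + 1) (by omega)]
      exact hwalk j (by omega) (by omega)
  have hn : n = 2 * k + 1 := by omega
  by_cases hk3 : 3 ≤ k
  · have hd : Detour G n (fun t => c (0 - t)) k (k + 1) p := by
      refine ⟨hc.reflect 0, by omega, hc.inducedOn_of_bound (fun l l1 _ => arcBound hJ hP l1) hwalk
        hfirst hlast (fun j _ _ => hclean _) le_rfl (by omega), by simpa using hfirst, ?_,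
        by omega, by omega, fun i t i1 i2 => hoff i _ i1 i2,
        fun j _ _ => (hclean _).reflect hc.hole 0, fun l l1 _ => arcBound hJ hP l1⟩
      rw [hlast]
      exact hc.hole.periodic _ _ (by omega)
    have := hd.no_near_rung hJ hP (by omega) i (n - x) i1 i2 (by omega) (by omega)
    apply this
    rwa [show (0 : ℤ) - (n - x) = x - n by omega, hc.hole.sub_period]
  · obtain rfl : i = 1 := by omega
    obtain rfl : k = 2 := by omega
    have h0 := hwalk 0 le_rfl (by omega)
    have h1 := hwalk 1 (by omega) (by omega)
    rw [hfirst] at h0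
    rw [one_add_one_eq_two] at h1
    rw [Nat.cast_ofNat] at hlast
    rw [hlast] at h1
    have := (hclean (p 1)).gap hc.hole h0.symm h1 hx (by omega) (by omega) (by omega)
    omega

/-- In a clean shortest odd hole, a path joining `c 0` and `c k` that is as short as the arc
between them closes up the other arc to a hole of the same length. -/
theorem ShortestOddCyclicHole.exists_replace_arc {G : SimpleGraph V} (hJ : ¬ ContainsJewel G)
    (hP : ¬ ContainsPyramid G) {n : ℤ} {k : ℕ} {c p : ℤ → V}
    (hc : ShortestOddCyclicHole G n c) (hclean : ∀ w, IsMinor G n c w) (hk : 2 ≤ k)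
    (hkn : 2 * (k : ℤ) < n) (hwalk : ∀ i : ℤ, 0 ≤ i → i < k → G.Adj (p i) (p (i + 1)))
    (hfirst : p 0 = c 0) (hlast : p k = c k) :
    ∃ g, CyclicHole G n g ∧ (∀ t, (k : ℤ) ≤ t → t ≤ n → g t = c t) ∧
      ∀ t, n < t → t < k + n → g t = p (t + -n) := by
  have hn := hc.hole.four_le
  have hpath := hc.inducedOn_of_bound (fun l l1 _ => arcBound hJ hP l1) hwalk hfirst hlast
    (fun j _ _ => hclean _) le_rfl (by omega)
  have hfar := hc.far_from_geodesic hJ hP k hclean hkn hwalk hfirst hlast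
  have hzero : c n = p 0 := by rw [hfirst]; exact hc.hole.periodic _ _ (by omega)
  refine hc.hole.splice (q := fun t => p (t + -n)) (by omega) (by omega) (by omega) (by omega)
    (hpath.shift (-n) _ _ (by omega) (by omega)) ?_ ?_
  · intro s t s1 s2 t1 t2
    rcases t2.eq_or_lt with rfl | t2
    · rw [hzero]
      exact hpath.ne (by omega) (by omega) (by omega) (by omega) (by omega)
    rcases t1.eq_or_lt with rfl | t1
    · rw [← hlast]
      exact hpath.ne (by omega) (by omega) (by omega) (by omega) (by omega)
    exact (hfar _ _ (by omega) (by omega) t1 t2).1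
  · intro s t s1 s2 t1 t2
    rcases t2.eq_or_lt with rfl | t2
    · rw [hzero, hpath.adj_iff (by omega) (by omega) (by omega) (by omega)]
      omega
    rcases t1.eq_or_lt with rfl | t1
    · rw [← hlast, hpath.adj_iff (by omega) (by omega) (by omega) (by omega)]
      omega
    simp only [(hfar (s + -n) t (by omega) (by omega) t1 t2).2, false_iff]
    omega

lemma ZMod.intCast_ne_of_lt {n : ℕ} {s t : ℤ} (h : s < t) (h' : t < s + n) :
    (s : ZMod n) ≠ t := by
  rw [Ne, ZMod.intCast_eq_intCast_iff_dvd_sub]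
  intro hd
  have := Int.le_of_dvd (by omega) hd
  omega

lemma ZMod.intCast_eq_add_one_iff {n : ℕ} {s t : ℤ} (h : s < t) (h' : t < s + n) :
    ((t : ZMod n) = s + 1 ∨ (s : ZMod n) = t + 1) ↔ t = s + 1 ∨ t = s + n - 1 := by
  constructor
  · rintro (e | e)
    · left
      by_contra hne
      refine ZMod.intCast_ne_of_lt (n := n) (s := s + 1) (t := t) (by omega) (by omega) ?_
      rw [e]
      push_cast
      rfl
    · right
      by_contra hne
      refine ZMod.intCast_ne_of_lt (n := n) (s := t + 1) (t := s + n) (by omega) (by omega) ?_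
      push_cast
      rw [← e, ZMod.natCast_self, add_zero]
  · rintro (rfl | rfl)
    · simp
    · right
      simp

lemma IsHole.cyclicHole {G : SimpleGraph V} {n : ℕ} {f : ZMod n → V} (hf : IsHole G n f)
    (a : ZMod n) : CyclicHole G n (fun t : ℤ => f (a + t)) where
  four_le := by exact_mod_cast hf.1
  periodic s t h := by simp [h]
  ne s t h h' e := ZMod.intCast_ne_of_lt h h' (add_left_cancel (hf.2.1 e))
  adj_iff s t h h' := by
    rw [hf.2.2, ← ZMod.intCast_eq_add_one_iff h h', add_assoc,
      add_right_inj, add_assoc, add_right_inj]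

lemma CyclicHole.isHole {G : SimpleGraph V} {n : ℕ} {g : ℤ → V} (hg : CyclicHole G n g) :
    IsHole G n (fun z : ZMod n => g z.val) := by
  have hn : 4 ≤ n := by exact_mod_cast hg.four_le
  have : NeZero n := ⟨by omega⟩
  refine ⟨hn, ?_, ?_⟩
  · intro i j h
    have hi := i.val_lt
    have hj := j.val_lt
    rcases lt_trichotomy i.val j.val with hij | hij | hij
    · exact absurd h (hg.ne _ _ (by omega) (by omega))
    · exact ZMod.val_injective n hij
    · exact absurd h.symm (hg.ne _ _ (by omega) (by omega))
  · have key : ∀ i j : ZMod n, i.val < j.val →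
        (G.Adj (g i.val) (g j.val) ↔ j = i + 1 ∨ i = j + 1) := by
      intro i j hij
      have hj := j.val_lt
      rw [hg.adj_iff _ _ (by omega) (by omega),
        ← ZMod.intCast_eq_add_one_iff (by omega) (by omega)]
      simp
    intro i j
    rcases lt_trichotomy i.val j.val with hij | hij | hij
    · exact key i j hij
    · obtain rfl := ZMod.val_injective n hij
      have : Fact (1 < n) := ⟨by omega⟩
      simp
    · rw [G.adj_comm, key j i hij, or_comm]

lemma IsShortestOddHole.shortestOddCyclicHole {G : SimpleGraph V} {n : ℕ} {f : ZMod n → V}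
    (hf : IsShortestOddHole G n f) (a : ZMod n) :
    ShortestOddCyclicHole G n (fun t : ℤ => f (a + t)) where
  hole := hf.1.1.cyclicHole a
  odd := by exact_mod_cast hf.1.2
  le l g hg hl := by
    lift l to ℕ using by have := hg.four_le; omega
    exact_mod_cast hf.2 l _ ⟨hg.isHole, by exact_mod_cast hl⟩

lemma IsHole.isMinor {G : SimpleGraph V} {n : ℕ} {f : ZMod n → V} (hf : IsHole G n f)
    (a : ZMod n) {w : V} (hw : ¬ IsCMajor G f w) : IsMinor G n (fun t : ℤ => f (a + t)) w := by
  have hn := hf.1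
  obtain ⟨i, hi⟩ : ∃ i, ∀ j, G.Adj w (f j) → j = i - 1 ∨ j = i ∨ j = i + 1 := by
    by_cases h : w ∈ Set.range f
    · obtain ⟨i, rfl⟩ := h
      refine ⟨i, fun j hj => ?_⟩
      rcases (hf.2.2 i j).1 hj with h | h
      · exact .inr (.inr h)
      · exact .inl (by simp [h])
    · by_contra! hcon
      exact hw ⟨h, hcon⟩
  obtain ⟨z, hz⟩ := ZMod.intCast_surjective (i - a)
  obtain rfl : i = a + z := by rw [hz]; ring
  refine ⟨z - 1, fun t t1 t2 ht => ?_⟩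
  by_contra! hlt
  have off : ∀ s, z - 1 ≤ s → s ≤ z + 1 → a + (t : ZMod n) ≠ a + s := fun s s1 s2 e =>
    ZMod.intCast_ne_of_lt (s := s) (t := t) (by omega) (by omega) (add_left_cancel e).symm
  rcases hi _ ht with e | e | e
  · exact off (z - 1) (by omega) (by omega) (by rw [e]; push_cast; ring)
  · exact off z (by omega) (by omega) e
  · exact off (z + 1) (by omega) (by omega) (by rw [e]; push_cast; ring)

lemma CyclicHole.range_val {G : SimpleGraph V} {n : ℕ} {g : ℤ → V} (hg : CyclicHole G n g) :
    Set.range (fun z : ZMod n => g z.val) = Set.range g := by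
  have : NeZero n := ⟨by have := hg.four_le; omega⟩
  ext u
  constructor
  · rintro ⟨z, rfl⟩
    exact ⟨_, rfl⟩
  · rintro ⟨t, rfl⟩
    obtain ⟨e, he, e1, e2⟩ := hg.exists_period 0 t
    rw [zero_add] at e2
    lift t + e to ℕ using e1 with r hr
    refine ⟨r, ?_⟩
    rw [← he t, ← hr]
    simp only
    rw [ZMod.val_natCast_of_lt (by omega)]

lemma IsHole.exists_walk {G : SimpleGraph V} {n : ℕ} {f : ZMod n → V} (hf : IsHole G n f)
    (a : ZMod n) (k : ℕ) : ∃ w : G.Walk (f a) (f (a + k)), w.length = k := by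
  induction k with
  | zero => exact ⟨SimpleGraph.Walk.nil.copy rfl (by simp), by simp⟩
  | succ k ih =>
    obtain ⟨w, hw⟩ := ih
    refine ⟨w.concat ((hf.2.2 _ _).2 (.inl ?_)), by simp [hw]⟩
    push_cast
    ring

/-- Let `G` contain no jewel or pyramid, and let `C` be a clean shortest
odd hole in `G`. Let `u = f a` and `v = f b` be distinct nonadjacent vertices of `C`,
where the arc `L1` from `a` to `b = a + k`, of length `k` (with `2 ≤ k`, `2 * k < n`),
is the shorter of the two subpaths of `C` joining them, and `L2` (the arc from `b` back
to `a`, with vertex set `{f (a + t) : k ≤ t ≤ n}`) is the longer one. Then for every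
shortest path `P` in `G` between `u` and `v`, the subgraph `P ∪ L2` is a shortest odd
hole in `G`. -/
theorem shortest_path_plus_long_arc {V : Type*} [Fintype V] (G : SimpleGraph V)
    (hJ : ¬ ContainsJewel G) (hP : ¬ ContainsPyramid G)
    (n : ℕ) (f : ZMod n → V) (hC : IsShortestOddHole G n f)
    (hclean : ∀ v : V, ¬ IsCMajor G f v)
    (a b : ZMod n) (k : ℕ) (hk2 : 2 ≤ k) (hklt : 2 * k < n)
    (hb : b = a + (k : ZMod n))
    (m : ℕ) (p : Fin (m + 1) → V) (hp : IsPathMap G m p)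
    (hp0 : p 0 = f a) (hpl : p (Fin.last m) = f b)
    (hshort : m = G.dist (f a) (f b)) :
    ∃ g : ZMod (m + (n - k)) → V, IsShortestOddHole G (m + (n - k)) g ∧
      Set.range g =
        Set.range p ∪ {u : V | ∃ t : ℕ, k ≤ t ∧ t ≤ n ∧ u = f (a + (t : ZMod n))} := by
  have hhole := hC.1.1
  have hc := hC.shortestOddCyclicHole a
  have hminor := fun w => hhole.isMinor a (hclean w)
  have hn := hc.hole.four_le
  obtain ⟨q, hq⟩ : ∃ q : ℤ → V, ∀ i : Fin (m + 1), q (i : ℕ) = p i :=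
    ⟨fun t => p ⟨min t.toNat m, by omega⟩, fun i => congrArg p (Fin.ext (by simp; omega))⟩
  have hwalk : ∀ i : ℤ, 0 ≤ i → i < m → G.Adj (q i) (q (i + 1)) := by
    intro i i1 i2
    lift i to ℕ using i1
    have := hp.2 ⟨i, by omega⟩
    rwa [← hq, ← hq] at this
  have hfirst : q 0 = f (a + (0 : ℤ)) := by simpa [hp0] using hq 0
  have hlast : q m = f (a + (k : ℤ)) := by simpa [hpl, hb] using hq (Fin.last m)
  obtain rfl : m = k := by
    apply le_antisymm
    · obtain ⟨w, hw⟩ := hhole.exists_walk a k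
      rw [hshort, hb]
      exact (SimpleGraph.dist_le w).trans hw.le
    · have := arcBound hJ hP (m := m) (by omega) n _ hc q 0 m 0 k (by omega) hwalk hfirst hlast
        (fun i _ _ => hminor _)
      omega
  obtain ⟨g, hg, hgc, hgq⟩ := hc.exists_replace_arc hJ hP hminor hk2 (by omega) hwalk hfirst hlast
  rw [show m + (n - m) = n by omega]
  refine ⟨fun z => g z.val, ⟨⟨hg.isHole, hC.1.2⟩, hC.2⟩, ?_⟩
  rw [hg.range_val]
  ext u
  constructor
  · rintro ⟨t, rfl⟩
    obtain ⟨e, he, e1, e2⟩ := hg.exists_period m t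
    rw [← he t]
    lift t + e to ℕ using by omega with r
    by_cases hr : r ≤ n
    · exact .inr ⟨r, by omega, hr, by simpa using hgc r (by omega) (by omega)⟩
    · refine .inl ⟨⟨r - n, by omega⟩, ?_⟩
      rw [hgq r (by omega) (by omega), ← hq]
      congr 1
      simp only
      omega
  · rintro (⟨i, rfl⟩ | ⟨t, t1, t2, rfl⟩)
    · rw [← hq]
      have := i.isLt
      rcases Nat.eq_zero_or_pos i with h | h
      · exact ⟨n, by rw [hgc n (by omega) le_rfl, h, Nat.cast_zero, hfirst]; simp⟩
      rcases (show (i : ℕ) ≤ m by omega).eq_or_lt with h' | h'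
      · exact ⟨m, by rw [hgc m le_rfl (by omega), h', hlast]⟩
      · exact ⟨i + n, by rw [hgq _ (by omega) (by omega), add_neg_cancel_right]⟩
    · exact ⟨t, by simpa using hgc t (by omega) (by omega)⟩
end

section
/- Let C be a shortest odd hole in a graph G, let x be a C-major vertex, and let D be an x-gap in C. Then D has even length. -/
/-!
Common definitions: holes, odd holes, C-major vertices, induced paths,
pyramids, jewels, candidates, x-gaps, gaps and normal sets.
A hole of length `n` is encoded as an injective map `f : ZMod n → V`
such that adjacency in `G` between vertices of the hole holds exactly
for consecutive indices (i.e. the hole is an induced cycle).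
-/

variable {V : Type*}

theorem ZMod.eq_add_one_iff_val {k : ℕ} (i j : ZMod (k + 2)) :
    j = i + 1 ↔ (j.val = i.val + 1 ∨ (i.val = k + 1 ∧ j.val = 0)) := by
  have hi := ZMod.val_lt i
  have hj := ZMod.val_lt j
  rw [← (ZMod.val_injective (k + 2)).eq_iff, ZMod.val_add, ZMod.val_one'' (by omega)]
  rcases Nat.lt_or_ge (i.val + 1) (k + 2) with h | h
  · rw [Nat.mod_eq_of_lt h]
    omega
  · rw [show i.val + 1 = k + 2 by omega, Nat.mod_self]
    omega

theorem ZMod.add_natCast_inj_of_lt {n s t : ℕ} (a : ZMod n) (hs : s < n) (ht : t < n) :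
    a + (s : ZMod n) = a + (t : ZMod n) ↔ s = t := by
  rw [add_right_inj, ZMod.natCast_eq_natCast_iff', Nat.mod_eq_of_lt hs, Nat.mod_eq_of_lt ht]

/-- A gap of a vertex off a hole closes up, through that vertex, to a hole. -/
theorem IsXGap.exists_isHole {V : Type*} {G : SimpleGraph V} {n : ℕ} {f : ZMod n → V}
    (hC : IsHole G n f) {x : V} (hx : x ∉ Set.range f) {a : ZMod n} {l : ℕ}
    (hD : IsXGap G f x a l) : ∃ g : ZMod (l + 2) → V, IsHole G (l + 2) g := by
  obtain ⟨-, hinj, hadj⟩ := hC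
  obtain ⟨hl, hln, h0, h1, hint⟩ := hD
  have hxf : ∀ t : ℕ, t ≤ l → (G.Adj x (f (a + (t : ZMod n))) ↔ t = 0 ∨ t = l) := by
    intro t ht
    constructor
    · intro h
      by_contra hne
      exact hint t (by omega) (by omega) h
    · rintro (rfl | rfl)
      · simpa using h0
      · exact h1
  have hff : ∀ s t : ℕ, s ≤ l → t ≤ l →
      (G.Adj (f (a + (s : ZMod n))) (f (a + (t : ZMod n))) ↔ t = s + 1 ∨ s = t + 1) := by
    intro s t hs ht
    rw [hadj, ← ZMod.add_natCast_inj_of_lt a (show t < n by omega) (show s + 1 < n by omega),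
      ← ZMod.add_natCast_inj_of_lt a (show s < n by omega) (show t + 1 < n by omega)]
    push_cast
    simp only [add_assoc]
  refine ⟨fun i => if i.val ≤ l then f (a + (i.val : ZMod n)) else x, by omega, ?_, ?_⟩
  · intro i j hij
    have hi := ZMod.val_lt i
    have hj := ZMod.val_lt j
    apply ZMod.val_injective
    dsimp only at hij
    split_ifs at hij with h h' h'
    · exact (ZMod.add_natCast_inj_of_lt a (by omega) (by omega)).1 (hinj hij)
    · exact absurd ⟨_, hij⟩ hx
    · exact absurd ⟨_, hij.symm⟩ hx
    · omega
  · intro i j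
    have hi := ZMod.val_lt i
    have hj := ZMod.val_lt j
    rw [ZMod.eq_add_one_iff_val, ZMod.eq_add_one_iff_val]
    dsimp only
    split_ifs with h h' h'
    · rw [hff _ _ h h']
      omega
    · rw [G.adj_comm, hxf _ h]
      omega
    · rw [hxf _ h']
      omega
    · simp only [SimpleGraph.irrefl, false_iff]
      omega

/-- A gap of a major vertex misses at least two vertices of the hole. -/
theorem IsXGap.add_two_lt {V : Type*} {G : SimpleGraph V} {n : ℕ} {f : ZMod n → V} {x : V}
    (hx : IsCMajor G f x) {a : ZMod n} {l : ℕ} (hD : IsXGap G f x a l) : l + 2 < n := by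
  obtain ⟨hl, hln, -, -, hint⟩ := hD
  refine lt_of_le_of_ne hln fun hn => ?_
  subst hn
  obtain ⟨j, hj, hj1, hj2, hj3⟩ := hx.2 (a - 1)
  have hzero : (l : ZMod (l + 2)) + 2 = 0 := by
    have := ZMod.natCast_self (l + 2)
    push_cast at this
    exact this
  obtain ⟨t, ht, rfl⟩ : ∃ t : ℕ, t < l + 2 ∧ j = a + (t : ZMod (l + 2)) :=
    ⟨(j - a).val, ZMod.val_lt _, by rw [ZMod.natCast_zmod_val]; ring⟩
  refine hint t (Nat.pos_of_ne_zero ?_) (lt_of_le_of_ne (Nat.lt_succ_iff.1 ?_) ?_) hj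
  · rintro rfl
    exact hj3 (by simp)
  · refine lt_of_le_of_ne (Nat.lt_succ_iff.1 ht) ?_
    rintro rfl
    refine hj2 ?_
    push_cast
    linear_combination hzero
  · rintro rfl
    exact hj1 (by linear_combination hzero)

/-- Let `C` be a shortest odd hole in a graph `G`, let `x` be a
`C`-major vertex, and let `D` be an `x`-gap in `C`. Then `D` has even length. -/
theorem xgap_even {V : Type*} [Fintype V] (G : SimpleGraph V)
    (n : ℕ) (f : ZMod n → V) (hC : IsShortestOddHole G n f)
    (x : V) (hx : IsCMajor G f x)
    (a : ZMod n) (l : ℕ) (hD : IsXGap G f x a l) :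
    Even l := by
  by_contra hodd
  obtain ⟨g, hg⟩ := hD.exists_isHole hC.1.1 hx.1
  have hlt := hD.add_two_lt hx
  have hle := hC.2 (l + 2) g ⟨hg, (Nat.not_even_iff_odd.1 hodd).add_even even_two⟩
  omega
end

section
/- Let C be a hole in a graph G, and suppose there is no edge uv of C such that every C-major vertex is adjacent to at least one of u, v. Then there is a C-major vertex x and an x-gap in C of length at least three. -/
/-!
Common definitions: holes, odd holes, C-major vertices, induced paths,
pyramids, jewels, candidates, x-gaps, gaps and normal sets.
A hole of length `n` is encoded as an injective map `f : ZMod n → V`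
such that adjacency in `G` between vertices of the hole holds exactly
for consecutive indices (i.e. the hole is an induced cycle).
-/

variable {V : Type*}

/-- Let `C` be a hole in a graph `G`, and suppose there is no edge `uv`
of `C` such that every `C`-major vertex is adjacent to one of `u, v`. Then there is a
`C`-major vertex `x` and an `x`-gap in `C` of length at least three. -/
theorem no_heavy_edge_gives_long_gap {V : Type*} [Fintype V] (G : SimpleGraph V)
    (n : ℕ) (f : ZMod n → V) (hC : IsHole G n f)
    (h : ¬ ∃ i : ZMod n, ∀ v : V, IsCMajor G f v →
      (G.Adj v (f i) ∨ G.Adj v (f (i + 1)))) :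
    ∃ (x : V) (a : ZMod n) (l : ℕ), IsCMajor G f x ∧ IsXGap G f x a l ∧ 3 ≤ l := by
  classical
  have hn := hC.1
  have : NeZero n := ⟨by omega⟩
  push Not at h
  obtain ⟨x, hx, hx0, hx1⟩ := h 0
  -- Walk in both directions from the edge `f 0`, `f 1` to the nearest neighbours of `x`.
  have neg_cast : ∀ j : ZMod n, -((n - j.val : ℕ) : ZMod n) = j := fun j => by
    rw [Nat.cast_sub j.val_le]; simp
  obtain ⟨j₀, hj₀, -⟩ := hx.2 0
  have hp : ∃ t : ℕ, G.Adj x (f (t : ZMod n)) := ⟨j₀.val, by simpa using hj₀⟩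
  have hs : ∃ t : ℕ, G.Adj x (f (-(t : ZMod n))) := ⟨n - j₀.val, by rwa [neg_cast]⟩
  obtain ⟨p, hpx, hp_min⟩ : ∃ p : ℕ, G.Adj x (f (p : ZMod n)) ∧
      ∀ t < p, ¬ G.Adj x (f (t : ZMod n)) :=
    ⟨Nat.find hp, Nat.find_spec hp, fun _ => Nat.find_min hp⟩
  obtain ⟨s, hsx, hs_min⟩ : ∃ s : ℕ, G.Adj x (f (-(s : ZMod n))) ∧
      ∀ t < s, ¬ G.Adj x (f (-(t : ZMod n))) :=
    ⟨Nat.find hs, Nat.find_spec hs, fun _ => Nat.find_min hs⟩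
  have hp0 : p ≠ 0 := by rintro rfl; exact hx0 (by simpa using hpx)
  have hp1 : p ≠ 1 := by rintro rfl; exact hx1 (by simpa using hpx)
  have hs0 : s ≠ 0 := by rintro rfl; exact hx0 (by simpa using hsx)
  refine ⟨x, -(s : ZMod n), s + p, hx, ⟨by omega, ?_, hsx, by simpa using hpx, ?_⟩, by omega⟩
  · -- Otherwise all neighbours of `x` on the hole are among `f p` and `f (p + 1)`.
    by_contra hlong
    obtain ⟨j, hj, -, hjp, hjp'⟩ := hx.2 (p : ZMod n)
    have hle : p ≤ j.val := by
      by_contra hlt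
      exact hp_min j.val (by omega) (by simpa using hj)
    have hge : s ≤ n - j.val := by
      by_contra hlt
      exact hs_min (n - j.val) (by omega) (by rwa [neg_cast])
    have hj_eq : j.val = p ∨ j.val = p + 1 := by omega
    rcases hj_eq with h | h
    · exact hjp (by rw [← h]; simp)
    · exact hjp' (by rw [← ZMod.natCast_zmod_val j, h]; simp)
  · intro t _ ht
    rcases le_total s t with hst | hst
    · have := hp_min (t - s) (by omega)
      rwa [Nat.cast_sub hst, sub_eq_neg_add] at this
    · have := hs_min (s - t) (by omega)
      rwa [Nat.cast_sub hst, neg_sub, sub_eq_neg_add] at this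
end

section
/- Let C be a hole in a graph G, let x be a C-major vertex, and let D be an x-gap in C of length at least three with ends d1 and d2. Then the subpath of C between d1 and d2 other than D has length at least three; in particular, the distance in C between d1 and d2 is at least three. -/
/-!
Common definitions: holes, odd holes, C-major vertices, induced paths,
pyramids, jewels, candidates, x-gaps, gaps and normal sets.
A hole of length `n` is encoded as an injective map `f : ZMod n → V`
such that adjacency in `G` between vertices of the hole holds exactly
for consecutive indices (i.e. the hole is an induced cycle).
-/

variable {V : Type*}

/-- Let `C` be a hole in a graph `G`, let `x` be a `C`-major vertex,
and let `D` be an `x`-gap in `C` of length at least three, with ends `d1 = f a` and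
`d2 = f (a + l)`. Then the subpath of `C` between `d1` and `d2` other than `D`
(which has length `n - l`) has length at least three; in particular, the distance in
`C` between `d1` and `d2` is at least three. -/
theorem other_arc_long {V : Type*} [Fintype V] (G : SimpleGraph V)
    (n : ℕ) (f : ZMod n → V) (hC : IsHole G n f)
    (x : V) (hx : IsCMajor G f x)
    (a : ZMod n) (l : ℕ) (hD : IsXGap G f x a l) (h3 : 3 ≤ l) :
    3 ≤ n - l ∧ 3 ≤ min l (n - l) := by
  obtain ⟨-, hln, -, -, hgap⟩ := hD
  have : NeZero n := ⟨by omega⟩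
  suffices h : n ≠ l + 2 by omega
  intro hn
  have hl : (l : ZMod n) + 2 = 0 := by
    have := ZMod.natCast_self n
    rw [hn] at this ⊢
    exact_mod_cast this
  obtain ⟨j, hj, hj₁, hj₂, hj₃⟩ := hx.2 (a - 1)
  have hja : a + ((j - a).val : ZMod n) = j := by
    rw [ZMod.natCast_zmod_val]; ring
  have hlt := ZMod.val_lt (j - a)
  refine hgap (j - a).val ?_ ?_ (by rwa [hja])
  · refine Nat.pos_of_ne_zero fun h => hj₃ ?_
    rw [← hja, h]; push_cast; ring
  · by_contra hge
    obtain h | h : (j - a).val = l ∨ (j - a).val = l + 1 := by omega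
    · refine hj₁ ?_
      rw [← hja, h]
      linear_combination hl
    · refine hj₂ ?_
      rw [← hja, h]; push_cast
      linear_combination hl
end

section
/- Let G be a candidate, let C be a shortest odd hole in G, let x be a C-major vertex, and let D be an x-gap in C with ends d1 and d2 whose length is maximum over all y-gaps taken over all C-major vertices y. Then every C-major vertex other than x is either adjacent to both d1 and d2, or has a neighbour in the interior of D. -/
/-!
Common definitions: holes, odd holes, C-major vertices, induced paths,
pyramids, jewels, candidates, x-gaps, gaps and normal sets.
A hole of length `n` is encoded as an injective map `f : ZMod n → V`
such that adjacency in `G` between vertices of the hole holds exactly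
for consecutive indices (i.e. the hole is an induced cycle).
-/

variable {V : Type*}

/-- Let `G` be a candidate, `C` a shortest odd hole in `G`, `x` a
`C`-major vertex, and `D` an `x`-gap in `C` with ends `d1 = f a`, `d2 = f (a + l)`,
whose length is maximum over all `y`-gaps over all `C`-major vertices `y`. Then every
`C`-major vertex other than `x` is either adjacent to both `d1` and `d2`, or has a
neighbour in the interior of `D`. -/
theorem max_gap_covers_majors {V : Type*} [Fintype V] (G : SimpleGraph V)
    (hG : Candidate G) (n : ℕ) (f : ZMod n → V) (hC : IsShortestOddHole G n f)
    (x : V) (hx : IsCMajor G f x)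
    (a : ZMod n) (l : ℕ) (hD : IsXGap G f x a l)
    (hmax : ∀ (y : V) (b : ZMod n) (m : ℕ),
      IsCMajor G f y → IsXGap G f y b m → m ≤ l) :
    ∀ v : V, IsCMajor G f v → v ≠ x →
      (G.Adj v (f a) ∧ G.Adj v (f (a + (l : ZMod n)))) ∨
        ∃ t : ℕ, 0 < t ∧ t < l ∧ G.Adj v (f (a + (t : ZMod n))) := by
  classical
  intro v hv _
  by_contra! h
  obtain ⟨hends, hint⟩ := h
  have hn : 4 ≤ n := hC.1.1.1
  have : NeZero n := ⟨by omega⟩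
  have index (b j : ZMod n) : j = b + ((j - b).val : ZMod n) := by simp
  obtain ⟨j₀, hj₀, -⟩ := hv.2 0
  -- The first neighbours of `v` met when walking away from `D` in the two directions.
  have hfwd : ∃ s : ℕ, l ≤ s ∧ G.Adj v (f (a + (s : ZMod n))) := by
    refine ⟨(j₀ - a).val + n, by have := hD.2.1; omega, ?_⟩
    simpa using hj₀
  have hbwd : ∃ r : ℕ, G.Adj v (f (a - (r : ZMod n))) := ⟨(a - j₀).val, by simpa using hj₀⟩
  obtain ⟨hls, hs⟩ := Nat.find_spec hfwd
  have hr := Nat.find_spec hbwd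
  have hsmin := fun t => Nat.find_min hfwd (m := t)
  have hrmin := fun t => Nat.find_min hbwd (m := t)
  generalize Nat.find hfwd = s at hls hs hsmin
  generalize Nat.find hbwd = r at hr hrmin
  have hlt : l < r + s := by
    by_contra hle
    obtain ⟨rfl, rfl⟩ : r = 0 ∧ s = l := by omega
    exact hends (by simpa using hr) hs
  have hgap : ∀ t : ℕ, 0 < t → t < r + s →
      ¬ G.Adj v (f (a - (r : ZMod n) + (t : ZMod n))) := by
    intro t ht0 ht hadj
    rcases le_or_gt t r with htr | htr
    · obtain ⟨u, rfl⟩ := Nat.exists_eq_add_of_le htr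
      refine hrmin u (by omega) ?_
      convert hadj using 2
      push_cast
      ring
    · obtain ⟨u, rfl⟩ := Nat.exists_eq_add_of_le htr.le
      have hu : G.Adj v (f (a + (u : ZMod n))) := by
        convert hadj using 2
        push_cast
        ring
      rcases lt_or_ge u l with hul | hul
      · exact hint u (by omega) hul hu
      · exact hsmin u (by omega) ⟨hul, hu⟩
  have hlen : r + s + 2 ≤ n := by
    by_contra hlong
    obtain ⟨j, hj, hjp, hj0, hj1⟩ := hv.2 (a - (r : ZMod n))
    have hjt := index (a - (r : ZMod n)) j
    have htn := ZMod.val_lt (j - (a - (r : ZMod n)))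
    generalize (j - (a - (r : ZMod n))).val = t at hjt htn
    subst hjt
    have ht0 : t ≠ 0 := by rintro rfl; simp at hj0
    have htl : t ≠ n - 1 := by
      rintro rfl
      rw [Nat.cast_sub (by omega)] at hjp
      simp [sub_eq_add_neg] at hjp
    exact hgap t (by omega) (by omega) hj
  have hle := hmax v (a - (r : ZMod n)) (r + s) hv
    ⟨by have := hD.1; omega, hlen, hr, by convert hs using 2; push_cast; ring, hgap⟩
  omega
end

section
/- Let C be a hole in a graph G, and let v ∈ V(G)\V(C) have exactly three neighbours a, b, c in V(C), where a and b are adjacent and c is adjacent to neither a nor b. Then the subgraph of G induced on V(C) ∪ {v} is a pyramid. -/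
/-!
Common definitions: holes, odd holes, C-major vertices, induced paths,
pyramids, jewels, candidates, x-gaps, gaps and normal sets.
A hole of length `n` is encoded as an injective map `f : ZMod n → V`
such that adjacency in `G` between vertices of the hole holds exactly
for consecutive indices (i.e. the hole is an induced cycle).
-/

variable {V : Type*}

/-- Natural numbers below `2 * n` agree in `ZMod n` only if they are equal or differ by `n`. -/
theorem ZMod.natCast_eq_natCast_iff_of_lt_two_mul {n s t : ℕ} (hs : s < 2 * n) (ht : t < 2 * n) :
    (s : ZMod n) = t ↔ s = t ∨ s = t + n ∨ t = s + n := by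
  rw [ZMod.natCast_eq_natCast_iff]
  constructor
  · intro h
    obtain ⟨q, hq⟩ := h.dvd
    have h1 : q < 2 := by
      by_contra hlt
      have : (n : ℤ) * 2 ≤ n * q := by gcongr; omega
      omega
    have h2 : -2 < q := by
      by_contra hlt
      have : (n : ℤ) * q ≤ n * (-2) := by gcongr; omega
      omega
    interval_cases q <;> omega
  · rintro (h | h | h) <;> simp [Nat.ModEq, h]

/-- The pyramid with apex `h 0` formed by a hole, traversed once by `h 0, …, h n = h 0`, and a
vertex `v` whose neighbours on the hole are `h 0`, `h k` and `h (k + 1)`. -/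
theorem isPyramid_of_closed_traversal {V : Type*} {G : SimpleGraph V} {n k : ℕ} {h : ℕ → V} {v : V}
    (hk : 2 ≤ k) (hkn : k + 3 ≤ n)
    (hinj : ∀ s t, s ≤ n → t ≤ n →
      (h s = h t ↔ s = t ∨ s = t + n ∨ t = s + n))
    (hadj : ∀ s t, s ≤ n → t ≤ n → (G.Adj (h s) (h t) ↔
      s + 1 = t ∨ t + 1 = s ∨ s + 1 = t + n ∨ t + 1 = s + n))
    (hv : ∀ s, h s ≠ v)
    (hnbr : ∀ s, s ≤ n → (G.Adj v (h s) ↔ s = 0 ∨ s = n ∨ s = k ∨ s = k + 1)) :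
    IsPyramid G (h 0) (h k) (h (k + 1)) v k (n - k - 1) 1
      (fun i => h i) (fun i => h (n - i)) ![h 0, v] := by
  have hnbr' : ∀ s, s ≤ n → (G.Adj (h s) v ↔ s = 0 ∨ s = n ∨ s = k ∨ s = k + 1) := fun s hs => by
    rw [G.adj_comm, hnbr s hs]
  refine ⟨⟨?_, ?_⟩, ⟨?_, ?_⟩, ⟨?_, ?_⟩, rfl, ?_, rfl, by simp, ?_, rfl, ?_, ?_, (hv 0).symm,
    ?_, ?_, ?_, Or.inl ⟨hk, by omega⟩, ?_, ?_, ?_, ?_, ?_, ?_⟩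
  · intro i j hij
    have := (hinj i j (by omega) (by omega)).1 hij
    ext; omega
  · intro i j
    have := hadj i j (by omega) (by omega)
    dsimp only; rw [this]; omega
  · intro i j hij
    have := (hinj (n - i) (n - j) (by omega) (by omega)).1 hij
    ext; omega
  · intro i j
    have := hadj (n - i) (n - j) (by omega) (by omega)
    dsimp only; rw [this]; omega
  · intro i j hij
    fin_cases i <;> fin_cases j <;> simp_all [eq_comm]
  · have h0 := (hnbr 0 (by omega)).2 (Or.inl rfl)
    intro i j
    fin_cases i <;> fin_cases j <;> simp [h0, h0.symm]
  · simp only [Fin.val_zero, Nat.sub_zero]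
    exact (hinj n 0 (by omega) (by omega)).2 (by omega)
  · simp only [Fin.val_last]; congr 1; omega
  · rw [Ne, hinj k 0 (by omega) (by omega)]; omega
  · rw [Ne, hinj (k + 1) 0 (by omega) (by omega)]; omega
  · rw [hadj k (k + 1) (by omega) (by omega)]; omega
  · rw [hnbr' k (by omega)]; omega
  · rw [hnbr' (k + 1) (by omega)]; omega
  · rintro _ ⟨⟨i, rfl⟩, j, hj⟩
    have := (hinj (n - j) i (by omega) (by omega)).1 hj
    exact (hinj i 0 (by omega) (by omega)).2 (by omega)
  · rintro _ ⟨⟨i, rfl⟩, j, hj⟩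
    fin_cases j
    · exact hj.symm
    · exact absurd hj.symm (hv _)
  · rintro _ ⟨⟨i, rfl⟩, j, hj⟩
    fin_cases j
    · exact hj.symm
    · exact absurd hj.symm (hv _)
  · rintro _ _ ⟨i, rfl⟩ ⟨j, rfl⟩ hi hj hij
    dsimp only at hi hj hij ⊢
    rw [hadj i (n - j) (by omega) (by omega)] at hij
    rw [Ne, hinj i 0 (by omega) (by omega)] at hi
    rw [Ne, hinj (n - j) 0 (by omega) (by omega)] at hj
    constructor <;> congr 1 <;> omega
  · rintro _ _ ⟨i, rfl⟩ ⟨j, rfl⟩ hi hj hij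
    fin_cases j
    · exact absurd rfl hj
    · refine ⟨?_, rfl⟩
      have := (hnbr' i (by omega)).1 hij
      rw [Ne, hinj i 0 (by omega) (by omega)] at hi
      dsimp only; congr 1; omega
  · rintro _ _ ⟨i, rfl⟩ ⟨j, rfl⟩ hi hj hij
    fin_cases j
    · exact absurd rfl hj
    · refine ⟨?_, rfl⟩
      have := (hnbr' (n - i) (by omega)).1 hij
      rw [Ne, hinj (n - i) 0 (by omega) (by omega)] at hi
      dsimp only; congr 1; omega

/-- A vertex whose neighbours on a hole are two consecutive vertices and a third vertex adjacent to
neither of them forms a pyramid with the hole. -/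
theorem exists_isPyramid_of_consecutive {V : Type*} {G : SimpleGraph V}
    {n : ℕ} {f : ZMod n → V} (hC : IsHole G n f) {v : V} (hv : v ∉ Set.range f)
    {ia ic : ZMod n} (hac : ia ≠ ic) (hbc : ia + 1 ≠ ic)
    (hnbrs : ∀ i : ZMod n, G.Adj v (f i) ↔ (i = ia ∨ i = ia + 1 ∨ i = ic))
    (hca : ¬ G.Adj (f ic) (f ia)) (hcb : ¬ G.Adj (f ic) (f (ia + 1))) :
    ∃ (v0 v1 v2 v3 : V) (k1 k2 k3 : ℕ) (p1 : Fin (k1 + 1) → V)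
      (p2 : Fin (k2 + 1) → V) (p3 : Fin (k3 + 1) → V),
      IsPyramid G v0 v1 v2 v3 k1 k2 k3 p1 p2 p3 ∧
        Set.range p1 ∪ Set.range p2 ∪ Set.range p3 = Set.range f ∪ {v} := by
  obtain ⟨hn, hfinj, hfadj⟩ := hC
  have : NeZero n := ⟨by omega⟩
  obtain ⟨k, hkn, rfl⟩ : ∃ k : ℕ, k < n ∧ ia = ic + k :=
    ⟨(ia - ic).val, ZMod.val_lt _, by simp⟩
  have cast_eq : ∀ s t : ℕ, s ≤ n → t ≤ n →
      ((s : ZMod n) = t ↔ s = t ∨ s = t + n ∨ t = s + n) := fun s t hs ht =>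
    ZMod.natCast_eq_natCast_iff_of_lt_two_mul (by omega) (by omega)
  have cast_succ : ∀ s t : ℕ, s ≤ n → t ≤ n →
      ((s : ZMod n) = t + 1 ↔ s = t + 1 ∨ s = t + 1 + n ∨ t + 1 = s + n) := fun s t hs ht => by
    rw [← Nat.cast_succ, ZMod.natCast_eq_natCast_iff_of_lt_two_mul (by omega) (by omega)]
  have hinj : ∀ s t : ℕ, s ≤ n → t ≤ n →
      (f (ic + s) = f (ic + t) ↔ s = t ∨ s = t + n ∨ t = s + n) := fun s t hs ht => by
    rw [hfinj.eq_iff, add_right_inj, cast_eq s t hs ht]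
  have hadj : ∀ s t : ℕ, s ≤ n → t ≤ n → (G.Adj (f (ic + s)) (f (ic + t)) ↔
      s + 1 = t ∨ t + 1 = s ∨ s + 1 = t + n ∨ t + 1 = s + n) := fun s t hs ht => by
    rw [hfadj, add_assoc, add_assoc, add_right_inj, add_right_inj, cast_succ s t hs ht,
      cast_succ t s ht hs]
    omega
  have hk0 : k ≠ 0 := by rintro rfl; simp at hac
  have hca' := hadj 0 k (by omega) (by omega)
  have hcb' := hadj 0 (k + 1) (by omega) (by omega)
  have hbc' : k + 1 ≠ n := by rintro rfl; simp [add_assoc] at hbc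
  simp only [Nat.cast_zero, add_zero, Nat.cast_add, Nat.cast_one, ← add_assoc] at hca' hcb'
  rw [hca'] at hca
  rw [hcb'] at hcb
  refine ⟨_, _, _, _, _, _, _, _, _, _, isPyramid_of_closed_traversal (n := n) (k := k)
    (h := fun s : ℕ => f (ic + s)) (v := v) (by omega) (by omega) hinj hadj
    (fun s hs => hv ⟨_, hs⟩) ?_, ?_⟩
  · intro s hs
    have h0 := cast_eq s 0 hs (by omega)
    rw [Nat.cast_zero] at h0
    rw [hnbrs, add_assoc, add_right_inj, add_right_inj, add_eq_left, cast_eq s k hs hkn.le,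
      cast_succ s k hs hkn.le, h0]
    omega
  · ext x
    constructor
    · rintro ((⟨i, rfl⟩ | ⟨i, rfl⟩) | ⟨i, rfl⟩)
      · exact Or.inl ⟨_, rfl⟩
      · exact Or.inl ⟨_, rfl⟩
      · fin_cases i
        · exact Or.inl ⟨_, rfl⟩
        · exact Or.inr rfl
    · rintro (⟨i, rfl⟩ | rfl)
      · obtain ⟨t, ht, rfl⟩ : ∃ t : ℕ, t < n ∧ i = ic + t :=
          ⟨(i - ic).val, ZMod.val_lt _, by simp⟩
        rcases le_or_gt t k with htk | htk
        · exact Or.inl (Or.inl ⟨⟨t, by omega⟩, rfl⟩)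
        · refine Or.inl (Or.inr ⟨⟨n - t, by omega⟩, ?_⟩)
          dsimp only
          rw [Nat.sub_sub_self ht.le]
      · exact Or.inr ⟨1, rfl⟩

/-- Let `C` be a hole in a graph `G`, and let `v ∉ V(C)` have exactly
three neighbours `f ia, f ib, f ic` in `V(C)`, where `f ia` and `f ib` are adjacent
and `f ic` is adjacent to neither. Then the subgraph of `G` induced on `V(C) ∪ {v}`
is a pyramid (i.e. there is a pyramid in `G` whose vertex set is `V(C) ∪ {v}`). -/
theorem three_neighbours_give_pyramid {V : Type*} [Fintype V] (G : SimpleGraph V)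
    (n : ℕ) (f : ZMod n → V) (hC : IsHole G n f)
    (v : V) (hv : v ∉ Set.range f)
    (ia ib ic : ZMod n) (hab : ia ≠ ib) (hac : ia ≠ ic) (hbc : ib ≠ ic)
    (hnbrs : ∀ i : ZMod n, G.Adj v (f i) ↔ (i = ia ∨ i = ib ∨ i = ic))
    (hadjab : G.Adj (f ia) (f ib))
    (hca : ¬ G.Adj (f ic) (f ia)) (hcb : ¬ G.Adj (f ic) (f ib)) :
    ∃ (v0 v1 v2 v3 : V) (k1 k2 k3 : ℕ) (p1 : Fin (k1 + 1) → V)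
      (p2 : Fin (k2 + 1) → V) (p3 : Fin (k3 + 1) → V),
      IsPyramid G v0 v1 v2 v3 k1 k2 k3 p1 p2 p3 ∧
        Set.range p1 ∪ Set.range p2 ∪ Set.range p3 = Set.range f ∪ {v} := by
  rcases (hC.2.2 ia ib).1 hadjab with rfl | rfl
  · exact exists_isPyramid_of_consecutive hC hv hac hbc hnbrs hca hcb
  · exact exists_isPyramid_of_consecutive hC hv hbc hac
      (fun i => (hnbrs i).trans or_left_comm) hcb hca
end
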